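/- Let s ∈ [0,2], t ∈ (1,2], and let μ, ν be Borel probability measures on ℝ² with finite s-energy I_s(μ) < ∞ and finite t-energy I_t(ν) < ∞. Then for every 0 ≤ σ < min{s + t − 1, 1}, the pair (μ,ν) has σ-thin tubes; in particular, there exists x ∈ spt(μ) with dim_H π_x(spt(ν) \ {x}) ≥ σ. -/

import Mathlib

open Metric MeasureTheory Set
open scoped ENNReal NNReal RealInnerProductSpace

noncomputable section

abbrev E2 := EuclideanSpace ℝ (Fin 2)

/-- Radial projection `π_x(y) = (y-x)/|y-x|`. -/
def radProj {E : Type*} [NormedAddCommGroup E] [NormedSpace ℝ E] (x y : E) : E :=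
  ‖y - x‖⁻¹ • (y - x)

/-- A subset of a real vector space is an affine line. -/
def IsAffineLine {E : Type*} [AddCommGroup E] [Module ℝ E] (ℓ : Set E) : Prop :=
  ∃ a v : E, v ≠ 0 ∧ ℓ = {p | ∃ t : ℝ, p = a + t • v}

/-- The (topological) support of a measure. -/
def msupport {E : Type*} [PseudoMetricSpace E] [MeasurableSpace E] (μ : Measure E) : Set E :=
  {x | ∀ r : ℝ, 0 < r → 0 < μ (ball x r)}

/-- `(μ,ν)` has `(t,K,c)`-thin tubes. -/
def ThinTubesWith (μ ν : Measure E2) (t K c : ℝ) : Prop :=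
  ∃ G : Set (E2 × E2), MeasurableSet G ∧ G ⊆ (msupport μ) ×ˢ (msupport ν) ∧
    ENNReal.ofReal c ≤ (μ.prod ν) G ∧
    ∀ x ∈ msupport μ, ∀ r : ℝ, 0 < r → ∀ ℓ : Set E2, IsAffineLine ℓ →
      x ∈ cthickening r ℓ →
      ν (cthickening r ℓ ∩ {y | (x, y) ∈ G}) ≤ ENNReal.ofReal (K * r ^ t)

/-- `(μ,ν)` has `t`-thin tubes. -/
def ThinTubes (μ ν : Measure E2) (t : ℝ) : Prop :=
  ∃ K c : ℝ, 0 < K ∧ 0 < c ∧ ThinTubesWith μ ν t K c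

/-- The `u`-energy of a measure. -/
def energy {E : Type*} [PseudoMetricSpace E] [MeasurableSpace E]
    (μ : Measure E) (u : ℝ) : ℝ≥0∞ :=
  ∫⁻ x, ∫⁻ y, edist x y ^ (-u) ∂μ ∂μ

theorem integrable_of_bounded_of_eq_zero {α : Type*} [MeasurableSpace α] {μ : Measure α}
    {f : α → ℝ} {S : Set α} {C : ℝ} (hf : Measurable f) (hS : μ S ≠ ⊤)
    (hC : ∀ x, |f x| ≤ C) (h0 : ∀ x, x ∉ S → f x = 0) : Integrable f μ := by
  rw [← integrableOn_iff_integrable_of_support_subset (s := S)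
    (fun x hx => by by_contra h; exact hx (h0 x h))]
  exact Measure.integrableOn_of_bounded hS hf.aestronglyMeasurable
    (Filter.Eventually.of_forall fun x => hC x)

/-- The tent function `max 0 (1 - |m|)`. -/
def tent (m : ℝ) : ℝ := max 0 (1 - |m|)

theorem tent_nonneg (m : ℝ) : 0 ≤ tent m := le_max_left _ _

theorem tent_le_one (m : ℝ) : tent m ≤ 1 :=
  max_le zero_le_one (by linarith [abs_nonneg m])

theorem tent_eq_zero {m : ℝ} (h : 1 ≤ |m|) : tent m = 0 := max_eq_left (by linarith)

theorem half_le_tent {m : ℝ} (h : |m| ≤ 1 / 2) : 1 / 2 ≤ tent m :=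
  le_max_of_le_right (by linarith)

theorem abs_tent_sub_tent_le (m n : ℝ) : |tent m - tent n| ≤ |m - n| := by
  refine (abs_max_sub_max_le_max 0 (1 - |m|) 0 (1 - |n|)).trans ?_
  rw [sub_self, abs_zero, max_eq_right (abs_nonneg _), sub_sub_sub_cancel_left, abs_sub_comm]
  exact abs_abs_sub_abs_le_abs_sub m n

theorem measurable_tent : Measurable tent := by
  unfold tent; fun_prop

/-- The difference of the normalized indicators of `[-a, a]` and `[-b, b]`. -/
def bump (a b v : ℝ) : ℝ :=
  (Icc (-a) a).indicator (fun _ => (2 * a)⁻¹) v - (Icc (-b) b).indicator (fun _ => (2 * b)⁻¹) v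

theorem measurable_bump (a b : ℝ) : Measurable (bump a b) :=
  (measurable_const.indicator measurableSet_Icc).sub (measurable_const.indicator measurableSet_Icc)

theorem bump_eq_zero {a b v : ℝ} (hab : a ≤ b) (hv : b < |v|) : bump a b v = 0 := by
  have h1 : v ∉ Icc (-a) a := fun h => by linarith [abs_le.2 h]
  have h2 : v ∉ Icc (-b) b := fun h => by linarith [abs_le.2 h]
  simp [bump, h1, h2]

theorem abs_bump_le {a b : ℝ} (ha : 0 < a) (hab : a ≤ b) (v : ℝ) : |bump a b v| ≤ (2 * a)⁻¹ := by
  have hb : (2 * b)⁻¹ ≤ (2 * a)⁻¹ := by gcongr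
  have hb0 : 0 < (2 * b)⁻¹ := by have := ha.trans_le hab; positivity
  unfold bump indicator
  rw [abs_le]
  split_ifs <;> constructor <;> linarith

theorem integrable_indicator_Icc (a c : ℝ) :
    Integrable ((Icc (-a) a).indicator fun _ : ℝ => c) :=
  (integrable_indicator_iff measurableSet_Icc).2 (integrableOn_const (by simp))

theorem integral_indicator_Icc {a : ℝ} (ha : 0 < a) :
    ∫ v, (Icc (-a) a).indicator (fun _ : ℝ => (2 * a)⁻¹) v = 1 := by
  rw [integral_indicator_const _ measurableSet_Icc]
  simp only [Measure.real, Real.volume_Icc, smul_eq_mul]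
  rw [ENNReal.toReal_ofReal (by linarith)]
  field_simp; ring

theorem integrable_bump (a b : ℝ) : Integrable (bump a b) :=
  (integrable_indicator_Icc a _).sub (integrable_indicator_Icc b _)

theorem integral_bump {a b : ℝ} (ha : 0 < a) (hb : 0 < b) : ∫ v, bump a b v = 0 := by
  unfold bump
  rw [integral_sub (integrable_indicator_Icc a _) (integrable_indicator_Icc b _),
    integral_indicator_Icc ha, integral_indicator_Icc hb, sub_self]

theorem integral_abs_bump_le {a b : ℝ} (ha : 0 < a) (hb : 0 < b) : ∫ v, |bump a b v| ≤ 2 := by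
  calc ∫ v, |bump a b v| ≤ ∫ v, ((Icc (-a) a).indicator (fun _ => (2 * a)⁻¹) v
        + (Icc (-b) b).indicator (fun _ => (2 * b)⁻¹) v) := by
        refine integral_mono (integrable_bump a b).abs
          ((integrable_indicator_Icc a _).add (integrable_indicator_Icc b _)) fun v => ?_
        refine (abs_sub _ _).trans_eq ?_
        rw [abs_of_nonneg (indicator_nonneg (fun _ _ => by positivity) v),
          abs_of_nonneg (indicator_nonneg (fun _ _ => by positivity) v)]
    _ = 2 := by
        rw [integral_add (integrable_indicator_Icc a _) (integrable_indicator_Icc b _),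
          integral_indicator_Icc ha, integral_indicator_Icc hb]
        norm_num

theorem integral_comp_sub_mul (g : ℝ → ℝ) (v P : ℝ) :
    ∫ m, g (v - m * P) = |P|⁻¹ * ∫ w, g w := by
  have h := Measure.integral_comp_mul_left (fun w => g (v - w)) P
  simp only [smul_eq_mul, abs_inv, integral_sub_left_eq_self (μ := volume) g v] at h
  simpa only [mul_comm P] using h

theorem abs_integral_tent_mul_bump_le_inv {a b : ℝ} (ha : 0 < a) (hab : a ≤ b) (v P : ℝ) :
    |∫ m, tent m * bump a b (v - m * P)| ≤ a⁻¹ := by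
  have h : ∫ m, tent m * bump a b (v - m * P) =
      ∫ m in Icc (-1) 1, tent m * bump a b (v - m * P) := by
    refine (setIntegral_eq_integral_of_forall_compl_eq_zero fun m hm => ?_).symm
    rw [tent_eq_zero, zero_mul]
    by_contra h
    exact hm (abs_le.1 (not_le.1 h).le)
  rw [h, ← Real.norm_eq_abs]
  refine (norm_setIntegral_le_of_norm_le_const (C := (2 * a)⁻¹) (by simp) fun m _ => ?_).trans ?_
  · rw [norm_mul, Real.norm_eq_abs, Real.norm_eq_abs, abs_of_nonneg (tent_nonneg m)]
    exact (mul_le_of_le_one_left (abs_nonneg _) (tent_le_one m)).trans (abs_bump_le ha hab _)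
  · simp only [Measure.real, Real.volume_Icc]
    rw [ENNReal.toReal_ofReal (by norm_num)]
    apply le_of_eq; field_simp; norm_num

theorem abs_integral_tent_mul_bump_le {a b : ℝ} (ha : 0 < a) (hab : a ≤ b) (v : ℝ) {P : ℝ}
    (hP : P ≠ 0) : |∫ m, tent m * bump a b (v - m * P)| ≤ 2 * b / P ^ 2 := by
  have hb := ha.trans_le hab
  have hP' : 0 < |P| := abs_pos.2 hP
  have hint : Integrable fun m => bump a b (v - m * P) := by
    have := ((integrable_bump a b).comp_sub_left v).comp_mul_left' hP
    simpa only [mul_comm P] using this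
  have hint' : Integrable fun m => tent m * bump a b (v - m * P) :=
    hint.bdd_mul (c := 1) measurable_tent.aestronglyMeasurable
      (Filter.Eventually.of_forall fun m => by
        rw [Real.norm_eq_abs, abs_of_nonneg (tent_nonneg m)]; exact tent_le_one m)
  have h0 : ∫ m, tent (v / P) * bump a b (v - m * P) = 0 := by
    rw [integral_const_mul, integral_comp_sub_mul, integral_bump ha hb]; simp
  have h1 : ∫ m, tent m * bump a b (v - m * P) =
      ∫ m, (tent m - tent (v / P)) * bump a b (v - m * P) := by
    simp_rw [sub_mul]
    rw [integral_sub hint' (hint.const_mul _), h0, sub_zero]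
  rw [h1]
  calc |∫ m, (tent m - tent (v / P)) * bump a b (v - m * P)|
      ≤ ∫ m, b / |P| * |bump a b (v - m * P)| := by
        refine abs_integral_le_integral_abs.trans (integral_mono_of_nonneg
          (Filter.Eventually.of_forall fun _ => abs_nonneg _) (hint.abs.const_mul _)
          (Filter.Eventually.of_forall fun m => ?_))
        simp only [abs_mul]
        rcases lt_or_ge b |v - m * P| with h | h
        · simp [bump_eq_zero hab h]
        · gcongr
          refine (abs_tent_sub_tent_le _ _).trans ?_
          rw [le_div_iff₀ hP', ← abs_mul, sub_mul, div_mul_cancel₀ _ hP, abs_sub_comm]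
          exact h
    _ ≤ b / |P| * (|P|⁻¹ * 2) := by
        rw [integral_const_mul, integral_comp_sub_mul (fun w => |bump a b w|)]
        gcongr
        exact integral_abs_bump_le ha hb
    _ = 2 * b / P ^ 2 := by
        rw [← sq_abs P]; field_simp

/-- The interaction, through lines of slope at most one, of two points with coordinates
`(P₁, Q₁)` and `(P₂, Q₂)`. -/
def lineKernel (a b P₁ Q₁ P₂ Q₂ : ℝ) : ℝ :=
  ∫ l : ℝ × ℝ, tent l.1 * bump a b (Q₁ - l.1 * P₁ - l.2) * bump a b (Q₂ - l.1 * P₂ - l.2)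

theorem lineKernel_eq {a b : ℝ} (ha : 0 < a) (hab : a ≤ b) (P₁ Q₁ P₂ Q₂ : ℝ) :
    lineKernel a b P₁ Q₁ P₂ Q₂ =
      ∫ w, bump a b w * ∫ m, tent m * bump a b (Q₁ - Q₂ + w - m * (P₁ - P₂)) := by
  have hmb := measurable_bump a b
  have hmt := measurable_tent
  have hb1 (x m w : ℝ) : |tent m * bump a b x * bump a b w| ≤ (2 * a)⁻¹ * (2 * a)⁻¹ := by
    rw [abs_mul, abs_mul, abs_of_nonneg (tent_nonneg m)]
    exact mul_le_mul ((mul_le_of_le_one_left (abs_nonneg _) (tent_le_one m)).trans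
      (abs_bump_le ha hab _)) (abs_bump_le ha hab _) (abs_nonneg _) (by positivity)
  have hbox (M : ℝ) : (volume.prod volume) (Icc (-1 : ℝ) 1 ×ˢ Icc (-M) M) ≠ ⊤ := by
    rw [Measure.prod_prod, Real.volume_Icc, Real.volume_Icc]
    exact ENNReal.mul_ne_top ENNReal.ofReal_ne_top ENNReal.ofReal_ne_top
  have h1 : Integrable (fun l : ℝ × ℝ =>
      tent l.1 * bump a b (Q₁ - l.1 * P₁ - l.2) * bump a b (Q₂ - l.1 * P₂ - l.2))
      (volume.prod volume) := by
    refine integrable_of_bounded_of_eq_zero (by fun_prop) (hbox (|Q₂| + |P₂| + b))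
      (fun l => hb1 _ _ _) fun l hl => ?_
    by_contra h
    refine hl ⟨abs_le.1 ?_, abs_le.1 ?_⟩
    · by_contra! h'
      exact h (by rw [tent_eq_zero h'.le]; simp)
    · have h2 : |Q₂ - l.1 * P₂ - l.2| ≤ b := by
        by_contra! h'
        exact h (by rw [bump_eq_zero hab h', mul_zero])
      have h3 : |l.1| ≤ 1 := by
        by_contra! h'
        exact h (by rw [tent_eq_zero h'.le]; simp)
      calc |l.2| = |Q₂ - l.1 * P₂ - (Q₂ - l.1 * P₂ - l.2)| := by congr 1; ring
        _ ≤ |Q₂| + |l.1 * P₂| + |Q₂ - l.1 * P₂ - l.2| :=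
          (abs_sub _ _).trans (add_le_add_left (abs_sub _ _) _)
        _ ≤ |Q₂| + |P₂| + b := by
          rw [abs_mul]
          gcongr
          exact mul_le_of_le_one_left (abs_nonneg _) h3
  have h2 : Integrable (Function.uncurry fun m w : ℝ =>
      tent m * bump a b (Q₁ - Q₂ + w - m * (P₁ - P₂)) * bump a b w) (volume.prod volume) := by
    refine integrable_of_bounded_of_eq_zero (by unfold Function.uncurry; fun_prop) (hbox b)
      (fun l => hb1 _ _ _) fun l hl => ?_
    by_contra h
    refine hl ⟨abs_le.1 ?_, abs_le.1 ?_⟩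
    · by_contra! h'
      exact h (by simp [Function.uncurry, tent_eq_zero h'.le])
    · by_contra! h'
      exact h (by simp [Function.uncurry, bump_eq_zero hab h'])
  rw [lineKernel, Measure.volume_eq_prod, integral_prod _ h1]
  calc ∫ m, ∫ c, tent m * bump a b (Q₁ - m * P₁ - c) * bump a b (Q₂ - m * P₂ - c)
      = ∫ m, ∫ w, tent m * bump a b (Q₁ - Q₂ + w - m * (P₁ - P₂)) * bump a b w := by
        congr 1; ext m
        rw [← integral_sub_left_eq_self _ volume (Q₂ - m * P₂)]
        congr 1; ext w
        congr 3 <;> ring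
    _ = ∫ w, ∫ m, tent m * bump a b (Q₁ - Q₂ + w - m * (P₁ - P₂)) * bump a b w :=
        integral_integral_swap h2
    _ = _ := by
        congr 1; ext w
        rw [integral_mul_const, mul_comm]

theorem abs_lineKernel_le {a b M P₁ Q₁ P₂ Q₂ : ℝ} (ha : 0 < a) (hab : a ≤ b) (hM : 0 ≤ M)
    (h : ∀ w, |w| ≤ b → |∫ m, tent m * bump a b (Q₁ - Q₂ + w - m * (P₁ - P₂))| ≤ M) :
    |lineKernel a b P₁ Q₁ P₂ Q₂| ≤ 2 * M := by
  rw [lineKernel_eq ha hab]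
  calc _ ≤ ∫ w, |bump a b w| * M := by
        refine abs_integral_le_integral_abs.trans (integral_mono_of_nonneg
          (Filter.Eventually.of_forall fun _ => abs_nonneg _)
          ((integrable_bump a b).abs.mul_const _) (Filter.Eventually.of_forall fun w => ?_))
        simp only [abs_mul]
        rcases lt_or_ge b |w| with hw | hw
        · simp [bump_eq_zero hab hw]
        · gcongr
          exact h w hw
    _ ≤ 2 * M := by
        rw [integral_mul_const]
        gcongr
        exact integral_abs_bump_le ha (ha.trans_le hab)

theorem abs_lineKernel_le_rpow {a b t d P₁ Q₁ P₂ Q₂ : ℝ} (ha : 0 < a) (hab : a ≤ b) (ht0 : 0 ≤ t)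
    (ht2 : t ≤ 2) (hd0 : 0 < d) (hd : d ≤ |P₁ - P₂| + |Q₁ - Q₂|) :
    |lineKernel a b P₁ Q₁ P₂ Q₂| ≤ 200 * b ^ t / a * d ^ (-t) := by
  have hb := ha.trans_le hab
  rw [Real.rpow_neg hd0.le, ← div_eq_mul_inv]
  have key {c : ℝ} (hc : 0 < c) (h1 : |lineKernel a b P₁ Q₁ P₂ Q₂| ≤ 2 * (c / a))
      (hu : c * (d / b) ^ t ≤ 100) : |lineKernel a b P₁ Q₁ P₂ Q₂| ≤ 200 * b ^ t / a / d ^ t := by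
    refine h1.trans ?_
    rw [Real.div_rpow hd0.le hb.le, mul_div_assoc', div_le_iff₀ (by positivity)] at hu
    rw [le_div_iff₀ (by positivity), mul_div_assoc', div_mul_eq_mul_div]
    gcongr ?_ / a
    linarith
  rcases lt_or_ge d (8 * b) with h | h
  · refine key (c := 1) one_pos (abs_lineKernel_le ha hab (by positivity) fun w _ => ?_) ?_
    · rw [one_div]
      exact abs_integral_tent_mul_bump_le_inv ha hab _ _
    · have h8 : d / b ≤ 8 := by rw [div_le_iff₀ hb]; exact h.le
      have : (d / b) ^ t ≤ 8 ^ t := Real.rpow_le_rpow (by positivity) h8 ht0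
      have h64 : (8 : ℝ) ^ t ≤ 8 ^ (2 : ℝ) := Real.rpow_le_rpow_of_exponent_le (by norm_num) ht2
      norm_num at h64
      linarith
  · have h8 : 8 ≤ d / b := by rw [le_div_iff₀ hb]; exact h
    have hdb : (d / b) ^ t ≤ (d / b) ^ 2 := by
      rw [← Real.rpow_natCast (d / b) 2]
      exact Real.rpow_le_rpow_of_exponent_le (by linarith) (by exact_mod_cast ht2)
    refine key (c := 32 / (d / b) ^ 2) (by positivity)
      (abs_lineKernel_le ha hab (by positivity) fun w hw => ?_) ?_
    · by_cases hz : ∃ m, |m| ≤ 1 ∧ |Q₁ - Q₂ + w - m * (P₁ - P₂)| ≤ b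
      · obtain ⟨m, hm1, hm2⟩ := hz
        have h1 : |Q₁ - Q₂| ≤ |P₁ - P₂| + 2 * b := by
          calc |Q₁ - Q₂| = |(Q₁ - Q₂ + w - m * (P₁ - P₂)) + (m * (P₁ - P₂) - w)| := by
                congr 1; ring
            _ ≤ |Q₁ - Q₂ + w - m * (P₁ - P₂)| + (|m * (P₁ - P₂)| + |w|) :=
              (abs_add_le _ _).trans (by gcongr; exact abs_sub _ _)
            _ ≤ b + (|P₁ - P₂| + b) := by
              rw [abs_mul]
              gcongr
              exact mul_le_of_le_one_left (abs_nonneg _) hm1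
            _ = _ := by ring
        have h2 : d / 4 ≤ |P₁ - P₂| := by linarith
        have hP : P₁ - P₂ ≠ 0 := abs_pos.1 (by linarith)
        refine (abs_integral_tent_mul_bump_le ha hab _ hP).trans ?_
        rw [← sq_abs, div_pow, div_div_eq_mul_div, div_div, div_le_div_iff₀ (by positivity)
          (by positivity)]
        have h3 : (d / 4) ^ 2 ≤ |P₁ - P₂| ^ 2 := by gcongr
        have h4 : d ^ 2 * a ≤ 16 * |P₁ - P₂| ^ 2 * b := by
          calc _ ≤ (16 * |P₁ - P₂| ^ 2) * a := by gcongr; linarith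
            _ ≤ _ := by gcongr
        nlinarith
      · have : (fun m => tent m * bump a b (Q₁ - Q₂ + w - m * (P₁ - P₂))) = 0 := by
          ext m
          rcases le_or_gt |m| 1 with hm | hm
          · have : b < |Q₁ - Q₂ + w - m * (P₁ - P₂)| := by
              by_contra! h'
              exact hz ⟨m, hm, h'⟩
            simp [bump_eq_zero hab this]
          · simp [tent_eq_zero hm.le]
        rw [this, integral_zero', abs_zero]
        positivity
    · rw [div_mul_eq_mul_div, div_le_iff₀ (by positivity)]
      nlinarith [sq_nonneg (d / b)]

/-- The set of points at vertical distance at most `r` from the line `q = l.1 * p + l.2`. -/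
def strip {α : Type*} (p q : α → ℝ) (l : ℝ × ℝ) (r : ℝ) : Set α :=
  {z | |q z - l.1 * p z - l.2| ≤ r}

section Strip

variable {α : Type*} {p q : α → ℝ}

theorem strip_mono {l : ℝ × ℝ} {r r' : ℝ} (h : r ≤ r') : strip p q l r ⊆ strip p q l r' :=
  fun _ hz => le_trans hz h

theorem volume_slab {f : ℝ → ℝ} (hf : Measurable f) (m₀ A B : ℝ) :
    volume {l : ℝ × ℝ | |l.1 - m₀| ≤ A ∧ |l.2 - f l.1| ≤ B} =
      ENNReal.ofReal (2 * B) * ENNReal.ofReal (2 * A) := by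
  have hm : MeasurableSet {l : ℝ × ℝ | |l.1 - m₀| ≤ A ∧ |l.2 - f l.1| ≤ B} := by
    rw [ofPred_and]
    exact (measurableSet_le (by fun_prop) (by fun_prop)).inter
      (measurableSet_le (by fun_prop) (by fun_prop))
  have hball (x r : ℝ) : {y | |y - x| ≤ r} = closedBall x r := by
    ext y; simp [Real.dist_eq]
  rw [Measure.volume_eq_prod, Measure.prod_apply hm]
  calc ∫⁻ m, volume (Prod.mk m ⁻¹' {l : ℝ × ℝ | |l.1 - m₀| ≤ A ∧ |l.2 - f l.1| ≤ B})
      = ∫⁻ m, (closedBall m₀ A).indicator (fun _ => ENNReal.ofReal (2 * B)) m := by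
        congr 1; ext m
        by_cases h : |m - m₀| ≤ A
        · rw [indicator_of_mem (by simpa [Real.dist_eq] using h), ← Real.volume_closedBall (f m) B,
            ← hball]
          simp [h]
        · rw [indicator_of_notMem (by simpa [Real.dist_eq] using h)]
          simp [h]
    _ = _ := by
        rw [lintegral_indicator measurableSet_closedBall, setLIntegral_const, Real.volume_closedBall]

theorem volume_setOf_mem_strip_le {x z : α} {δ A : ℝ} (hδ : 0 < δ) (hxz : δ ≤ p z - p x)
    (hA : 0 ≤ A) :
    volume {l : ℝ × ℝ | x ∈ strip p q l A ∧ z ∈ strip p q l A} ≤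
      ENNReal.ofReal (8 * A ^ 2 / δ) := by
  have hpos : 0 < p z - p x := hδ.trans_le hxz
  calc _ ≤ volume {l : ℝ × ℝ | |l.1 - (q z - q x) / (p z - p x)| ≤ 2 * A / δ ∧
        |l.2 - (fun m => q x - m * p x) l.1| ≤ A} := by
        refine measure_mono fun l ⟨h1, h2⟩ => ⟨?_, ?_⟩
        · have h3 : |l.1 - (q z - q x) / (p z - p x)| * (p z - p x) ≤ 2 * A := by
            rw [← abs_of_pos hpos, ← abs_mul, abs_of_pos hpos, sub_mul, div_mul_cancel₀ _ hpos.ne']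
            calc _ = |(q x - l.1 * p x - l.2) - (q z - l.1 * p z - l.2)| := by congr 1; ring
              _ ≤ A + A := (abs_sub _ _).trans (add_le_add h1 h2)
              _ = 2 * A := by ring
          rw [le_div_iff₀ hδ]
          exact (mul_le_mul_of_nonneg_left hxz (abs_nonneg _)).trans h3
        · have h4 : l.2 - (q x - l.1 * p x) = -(q x - l.1 * p x - l.2) := by ring
          simp only [h4, abs_neg]
          exact h1
    _ = _ := by
        rw [volume_slab (f := fun m => q x - m * p x) (by fun_prop), ← ENNReal.ofReal_mul (by positivity)]
        congr 1; ring

variable [MeasurableSpace α]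

theorem measurableSet_setOf_mem_strip (hp : Measurable p) (hq : Measurable q) (r : ℝ) :
    MeasurableSet {x : (ℝ × ℝ) × α | x.2 ∈ strip p q x.1 r} := by
  simp only [strip, mem_ofPred_eq]
  exact measurableSet_le (by fun_prop) (by fun_prop)

theorem measurableSet_strip (hp : Measurable p) (hq : Measurable q) (l : ℝ × ℝ) (r : ℝ) :
    MeasurableSet (strip p q l r) :=
  measurable_prodMk_left (measurableSet_setOf_mem_strip hp hq r)

theorem measurable_measure_strip (hp : Measurable p) (hq : Measurable q) (ν : Measure α)
    [SFinite ν] (r : ℝ) : Measurable fun l => ν (strip p q l r) :=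
  measurable_measure_prodMk_left (measurableSet_setOf_mem_strip hp hq r)

theorem integral_bump_line {ν : Measure α} [IsFiniteMeasure ν] (hp : Measurable p)
    (hq : Measurable q) (l : ℝ × ℝ) (a b : ℝ) :
    ∫ z, bump a b (q z - l.1 * p z - l.2) ∂ν =
      ν.real (strip p q l a) / (2 * a) - ν.real (strip p q l b) / (2 * b) := by
  have h (c : ℝ) (z : α) : (Icc (-c) c).indicator (fun _ => (2 * c)⁻¹) (q z - l.1 * p z - l.2) =
      (strip p q l c).indicator (fun _ => (2 * c)⁻¹) z := by
    simp only [indicator, strip, mem_Icc, abs_le, mem_ofPred_eq]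
  have hi (c : ℝ) : Integrable ((strip p q l c).indicator fun _ => (2 * c)⁻¹) ν :=
    (integrable_const _).indicator (measurableSet_strip hp hq l c)
  unfold bump
  simp_rw [h]
  rw [integral_sub (hi a) (hi b), integral_indicator_const _ (measurableSet_strip hp hq l a),
    integral_indicator_const _ (measurableSet_strip hp hq l b)]
  simp [div_eq_mul_inv]

theorem lintegral_tent_mul_sq_le [PseudoMetricSpace α] {ν : Measure α} [IsFiniteMeasure ν]
    (hp : Measurable p) (hq : Measurable q)
    (hdist : ∀ z z', dist z z' ≤ |p z - p z'| + |q z - q z'|) {a b t : ℝ}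
    (ha : 0 < a) (hab : a ≤ b) (ht0 : 0 < t) (ht2 : t ≤ 2) :
    ∫⁻ l : ℝ × ℝ, ENNReal.ofReal (tent l.1 *
      (ν.real (strip p q l a) / (2 * a) - ν.real (strip p q l b) / (2 * b)) ^ 2) ≤
    ENNReal.ofReal (200 * b ^ t / a) * ∫⁻ x : α × α, edist x.1 x.2 ^ (-t) ∂(ν.prod ν) := by
  have hb := ha.trans_le hab
  have hmb := measurable_bump a b
  have hmt := measurable_tent
  let F (l : ℝ × ℝ) (x : α × α) : ℝ := tent l.1 * bump a b (q x.1 - l.1 * p x.1 - l.2) *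
    bump a b (q x.2 - l.1 * p x.2 - l.2)
  have hFm : Measurable (Function.uncurry F) := by
    unfold Function.uncurry F; fun_prop
  have hF : Integrable (Function.uncurry F) (volume.prod (ν.prod ν)) := by
    let S : Set ((ℝ × ℝ) × (α × α)) :=
      {y | |y.1.1 - 0| ≤ 1 ∧ |y.1.2 - (q y.2.1 - y.1.1 * p y.2.1)| ≤ b}
    have hS : MeasurableSet S := by
      simp only [S, ofPred_and]
      exact (measurableSet_le (by fun_prop) (by fun_prop)).inter
        (measurableSet_le (by fun_prop) (by fun_prop))
    refine integrable_of_bounded_of_eq_zero (S := S) (C := (2 * a)⁻¹ * (2 * a)⁻¹) hFm ?_ ?_ ?_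
    · rw [Measure.prod_apply_symm hS]
      have (x : α × α) : volume ((fun l => (l, x)) ⁻¹' S) =
          ENNReal.ofReal (2 * b) * ENNReal.ofReal (2 * 1) :=
        volume_slab (f := fun m => q x.1 - m * p x.1) (by fun_prop) 0 1 b
      simp_rw [this]
      rw [lintegral_const]
      exact ENNReal.mul_ne_top (ENNReal.mul_ne_top ENNReal.ofReal_ne_top ENNReal.ofReal_ne_top)
        (measure_ne_top _ _)
    · rintro ⟨l, x⟩
      simp only [Function.uncurry, F]
      rw [abs_mul, abs_mul, abs_of_nonneg (tent_nonneg _)]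
      exact mul_le_mul ((mul_le_of_le_one_left (abs_nonneg _) (tent_le_one _)).trans
        (abs_bump_le ha hab _)) (abs_bump_le ha hab _) (abs_nonneg _) (by positivity)
    · rintro ⟨l, x⟩ hl
      by_contra h
      refine hl ⟨?_, ?_⟩
      · by_contra! h'
        rw [sub_zero] at h'
        exact h (by simp [Function.uncurry, F, tent_eq_zero h'.le])
      · by_contra! h'
        rw [abs_sub_comm] at h'
        exact h (by simp [Function.uncurry, F, bump_eq_zero hab h'])
  have hsq (l : ℝ × ℝ) : tent l.1 *
      (ν.real (strip p q l a) / (2 * a) - ν.real (strip p q l b) / (2 * b)) ^ 2 =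
      ∫ x, F l x ∂(ν.prod ν) := by
    rw [← integral_bump_line hp hq, sq, ← integral_prod_mul, ← integral_const_mul]
    simp only [F, mul_assoc]
  simp_rw [hsq]
  have hpos (l : ℝ × ℝ) : 0 ≤ ∫ x, F l x ∂(ν.prod ν) := by
    rw [← hsq]; exact mul_nonneg (tent_nonneg _) (sq_nonneg _)
  have hFl : Integrable (fun l => ∫ x, F l x ∂(ν.prod ν)) := hF.integral_prod_left
  rw [← ofReal_integral_eq_lintegral_ofReal hFl (Filter.Eventually.of_forall hpos),
    integral_integral_swap hF]
  refine (Real.ofReal_le_enorm _).trans ((enorm_integral_le_lintegral_enorm _).trans ?_)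
  rw [← lintegral_const_mul' _ _ ENNReal.ofReal_ne_top]
  refine lintegral_mono fun x => ?_
  change ‖lineKernel a b (p x.1) (q x.1) (p x.2) (q x.2)‖ₑ ≤ _
  rcases eq_or_ne (edist x.1 x.2) 0 with h0 | h0
  · rw [h0, ENNReal.zero_rpow_of_neg (by linarith), ENNReal.mul_top]
    · exact le_top
    · simp only [ne_eq, ENNReal.ofReal_eq_zero, not_le]; positivity
  · have hd : 0 < dist x.1 x.2 := by
      rw [edist_dist] at h0
      exact ENNReal.ofReal_pos.1 (pos_iff_ne_zero.2 h0)
    rw [edist_dist, ENNReal.ofReal_rpow_of_pos hd, ← ENNReal.ofReal_mul (by positivity),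
      Real.enorm_eq_ofReal_abs]
    exact ENNReal.ofReal_le_ofReal
      (abs_lineKernel_le_rpow ha hab ht0.le ht2 hd (hdist _ _))

end Strip

/-- The lines of slope at most `1 / 2` whose `2 * r`-strip has `ν`-mass at least `K * r ^ σ`,
while at all coarser dyadic scales the mass is not exceptionally large. -/
def heavyLines {α : Type*} [MeasurableSpace α] (p q : α → ℝ) (ν : Measure α) (K r σ : ℝ) :
    Set (ℝ × ℝ) :=
  {l | |l.1| ≤ 1 / 2 ∧ ENNReal.ofReal (K * r ^ σ) ≤ ν (strip p q l (2 * r)) ∧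
    ∀ j : ℕ, r ≤ (1 / 2) ^ (j + 1) →
      ν (strip p q l ((1 / 2) ^ (j + 1))) ≤ ENNReal.ofReal (K * ((1 / 2) ^ j) ^ σ)}

section HeavyLines

variable {α : Type*} [MeasurableSpace α] {p q : α → ℝ} {μ ν : Measure α}
  {K r σ : ℝ}

theorem measurableSet_heavyLines [SFinite ν] (hp : Measurable p) (hq : Measurable q) :
    MeasurableSet (heavyLines p q ν K r σ) := by
  have h := measurable_measure_strip hp hq ν
  simp only [heavyLines, ofPred_and, ofPred_forall]
  refine (measurableSet_le (by fun_prop) (by fun_prop)).inter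
    ((measurableSet_le (by fun_prop) (h _)).inter
      (MeasurableSet.iInter fun j => MeasurableSet.iInter fun _ => measurableSet_le (h _) ?_))
  fun_prop

theorem measure_strip_le_of_mem_heavyLines (hν : ν univ ≤ 1) (hK : 1 ≤ K)
    (hr : 0 < r) (hσ0 : 0 ≤ σ) (hσ1 : σ ≤ 1) {l : ℝ × ℝ} (hl : l ∈ heavyLines p q ν K r σ)
    {ρ : ℝ} (hρ : r ≤ ρ) : ν (strip p q l ρ) ≤ ENNReal.ofReal (4 * K * ρ ^ σ) := by
  have hρ0 : 0 < ρ := hr.trans_le hρ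
  rcases le_or_gt ρ (1 / 2) with h | h
  · obtain ⟨n, hn1, hn2⟩ := exists_nat_pow_near_of_lt_one (x := 2 * ρ) (y := (1 / 2 : ℝ))
      (by linarith) (by linarith) (by norm_num) (by norm_num)
    have hn3 : ρ ≤ (1 / 2) ^ (n + 1) := by rw [pow_succ]; linarith
    refine (measure_mono (strip_mono hn3)).trans ((hl.2.2 n (hρ.trans hn3)).trans ?_)
    refine ENNReal.ofReal_le_ofReal ?_
    have h4 : ((1 / 2 : ℝ) ^ n) ^ σ ≤ (4 * ρ) ^ σ := by
      refine Real.rpow_le_rpow (by positivity) ?_ hσ0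
      rw [pow_succ] at hn1
      linarith
    rw [Real.mul_rpow (by norm_num) hρ0.le] at h4
    have h5 : (4 : ℝ) ^ σ ≤ 4 := Real.rpow_le_self_of_one_le (by norm_num) hσ1
    calc K * ((1 / 2 : ℝ) ^ n) ^ σ ≤ K * (4 * ρ ^ σ) := by gcongr; exact h4.trans (by gcongr)
      _ = _ := by ring
  · refine (measure_mono (subset_univ _)).trans (hν.trans ?_)
    rw [← ENNReal.ofReal_one]
    refine ENNReal.ofReal_le_ofReal ?_
    have h1 : (1 / 2 : ℝ) ≤ (1 / 2) ^ σ := Real.self_le_rpow_of_le_one (by norm_num) (by norm_num) hσ1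
    have h2 : (1 / 2 : ℝ) ^ σ ≤ ρ ^ σ := Real.rpow_le_rpow (by norm_num) h.le hσ0
    nlinarith

theorem setLIntegral_measure_prodMk {β γ : Type*} [MeasurableSpace β] [MeasurableSpace γ]
    {m : Measure β} {n : Measure γ} [SFinite m] [SFinite n] {S : Set (β × γ)}
    (hS : MeasurableSet S) (L : Set β) :
    ∫⁻ l in L, n (Prod.mk l ⁻¹' S) ∂m = ∫⁻ z, m (L ∩ {l | (l, z) ∈ S}) ∂n := by
  rw [← Measure.prod_apply hS, Measure.prod_apply_symm hS]
  congr 1; ext z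
  rw [Measure.restrict_apply (measurable_prodMk_right hS), inter_comm]
  rfl

theorem setLIntegral_measure_strip [SFinite ν] (hp : Measurable p) (hq : Measurable q)
    (L : Set (ℝ × ℝ)) (r : ℝ) :
    ∫⁻ l in L, ν (strip p q l r) = ∫⁻ z, volume (L ∩ {l | z ∈ strip p q l r}) ∂ν :=
  setLIntegral_measure_prodMk (measurableSet_setOf_mem_strip hp hq r) L

theorem setLIntegral_measure_strip_mul [SFinite μ] [SFinite ν] (hp : Measurable p)
    (hq : Measurable q) (L : Set (ℝ × ℝ)) (r : ℝ) :
    ∫⁻ l in L, μ (strip p q l r) * ν (strip p q l r) =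
      ∫⁻ x, volume (L ∩ {l | x.1 ∈ strip p q l r ∧ x.2 ∈ strip p q l r}) ∂(μ.prod ν) := by
  have hS : MeasurableSet {y : (ℝ × ℝ) × (α × α) |
      y.2.1 ∈ strip p q y.1 r ∧ y.2.2 ∈ strip p q y.1 r} := by
    simp only [strip, mem_ofPred_eq, ofPred_and]
    exact (measurableSet_le (by fun_prop) (by fun_prop)).inter
      (measurableSet_le (by fun_prop) (by fun_prop))
  simp_rw [← Measure.prod_prod]
  exact setLIntegral_measure_prodMk hS L

theorem volume_heavyLines_le [PseudoMetricSpace α] [IsFiniteMeasure ν]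
    (hν : ν univ ≤ 1) (hp : Measurable p) (hq : Measurable q)
    (hdist : ∀ z z', dist z z' ≤ |p z - p z'| + |q z - q z'|) (hK : 1 ≤ K) (hr : 0 < r)
    (hσ0 : 0 ≤ σ) (hσ1 : σ < 1) {t R : ℝ} (ht0 : 0 < t) (ht2 : t ≤ 2) (hR : 2 ≤ R)
    (hRσ : 16 * R ^ (σ - 1) ≤ 1) :
    volume (heavyLines p q ν K r σ) ≤
      ENNReal.ofReal (12800 * R ^ t * K ^ (-2 : ℝ) * r ^ (1 + t - 2 * σ)) *
        ∫⁻ x : α × α, edist x.1 x.2 ^ (-t) ∂(ν.prod ν) := by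
  have hK0 : 0 < K := by linarith
  have hR0 : 0 < R := by linarith
  have hL := lintegral_tent_mul_sq_le (ν := ν) hp hq hdist (a := 2 * r) (b := R * r) (by positivity)
    (by gcongr) ht0 ht2
  have hmeas := measurableSet_heavyLines (ν := ν) (K := K) (r := r) (σ := σ) hp hq
  have hlow : ENNReal.ofReal (K ^ 2 * r ^ (2 * σ - 2) / 128) * volume (heavyLines p q ν K r σ) ≤
      ∫⁻ l : ℝ × ℝ, ENNReal.ofReal (tent l.1 * (ν.real (strip p q l (2 * r)) / (2 * (2 * r)) -
        ν.real (strip p q l (R * r)) / (2 * (R * r))) ^ 2) := by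
    rw [← setLIntegral_const]
    refine (setLIntegral_mono' hmeas fun l hl => ?_).trans (setLIntegral_le_lintegral _ _)
    refine ENNReal.ofReal_le_ofReal ?_
    have h1 : K * r ^ σ ≤ ν.real (strip p q l (2 * r)) :=
      (ENNReal.ofReal_le_iff_le_toReal (measure_ne_top _ _)).1 hl.2.1
    have h2 : ν.real (strip p q l (R * r)) ≤ 4 * K * (R * r) ^ σ :=
      ENNReal.toReal_le_of_le_ofReal (by positivity)
        (measure_strip_le_of_mem_heavyLines hν hK hr hσ0 hσ1.le hl (by nlinarith))
    have h3 : ν.real (strip p q l (R * r)) / (2 * (R * r)) ≤ K * r ^ σ / (8 * r) := by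
      rw [div_le_div_iff₀ (by positivity) (by positivity)]
      have h4 : 16 * R ^ σ ≤ R := by
        rw [Real.rpow_sub_one hR0.ne', mul_div_assoc', div_le_one hR0] at hRσ
        exact hRσ
      rw [Real.mul_rpow hR0.le hr.le] at h2
      calc _ ≤ 4 * K * (R ^ σ * r ^ σ) * (8 * r) := by gcongr
        _ = 2 * (K * r ^ σ * r) * (16 * R ^ σ) := by ring
        _ ≤ 2 * (K * r ^ σ * r) * R := by gcongr
        _ = _ := by ring
    have h5 : K * r ^ σ / (8 * r) ≤ ν.real (strip p q l (2 * r)) / (2 * (2 * r)) -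
        ν.real (strip p q l (R * r)) / (2 * (R * r)) := by
      have h6 : K * r ^ σ / (2 * (2 * r)) ≤ ν.real (strip p q l (2 * r)) / (2 * (2 * r)) := by
        gcongr
      have h7 : K * r ^ σ / (2 * (2 * r)) = K * r ^ σ / (8 * r) + K * r ^ σ / (8 * r) := by
        field_simp; norm_num
      linarith
    have h8 : r ^ (2 * σ - 2) = (r ^ σ / r) ^ 2 := by
      rw [div_pow, Real.rpow_sub hr, mul_comm 2 σ, Real.rpow_mul hr.le]
      norm_num
    calc K ^ 2 * r ^ (2 * σ - 2) / 128 = 1 / 2 * (K * r ^ σ / (8 * r)) ^ 2 := by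
          rw [h8]; field_simp; norm_num
      _ ≤ _ := by
          gcongr
          · exact tent_nonneg _
          · exact half_le_tent hl.1
  have h1 : ENNReal.ofReal (200 * (R * r) ^ t / (2 * r)) =
      ENNReal.ofReal (K ^ 2 * r ^ (2 * σ - 2) / 128) *
      ENNReal.ofReal (12800 * R ^ t * K ^ (-2 : ℝ) * r ^ (1 + t - 2 * σ)) := by
    rw [← ENNReal.ofReal_mul (by positivity)]
    congr 1
    rw [Real.mul_rpow hR0.le hr.le, Real.rpow_neg hK0.le, Real.rpow_two]
    have h2 : r ^ t = r ^ (2 * σ - 2) * r ^ (1 + t - 2 * σ) * r := by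
      rw [← Real.rpow_add hr, ← Real.rpow_add_one hr.ne']
      congr 1; ring
    rw [h2]
    field_simp; norm_num
  have h2 := hlow.trans hL
  rw [h1, mul_assoc] at h2
  exact (ENNReal.mul_le_mul_iff_right (by simp only [ne_eq, ENNReal.ofReal_eq_zero, not_le]; positivity)
    ENNReal.ofReal_ne_top).1 h2

end HeavyLines

/-- `Y` lies to the right of `X`, and all lines joining a point of `X` to a point of `Y` have slope
at most `1 / 4` in the coordinates `p`, `q`. -/
structure IsTransversal {α : Type*} [PseudoMetricSpace α] (p q : α → ℝ) (X Y : Set α)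
    (δ D : ℝ) : Prop where
  pos : 0 < δ
  one_le : 1 ≤ D
  le_sub : ∀ x ∈ X, ∀ y ∈ Y, δ ≤ p y - p x
  sub_le : ∀ x ∈ X, ∀ y ∈ Y, p y - p x ≤ D
  abs_sub_le : ∀ x ∈ X, ∀ y ∈ Y, |q y - q x| ≤ (p y - p x) / 4
  dist_le : ∀ x ∈ X, ∀ x' ∈ X, dist x x' ≤ D

section Transversal

variable {α : Type*} [PseudoMetricSpace α] {p q : α → ℝ} {X Y : Set α} {δ D K r s t σ : ℝ}

theorem mem_strip_of_mem_strip {x x' z : α} {l l₀ : ℝ × ℝ}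
    (hdist : dist x x' ≤ |p x - p x'| + |q x - q x'|) (hr : 0 < r) (hd : 4 * r ≤ dist x x')
    (hdD : dist x x' ≤ D) (hz0 : 0 ≤ p z - p x) (hzD : p z - p x ≤ D) (hl : |l.1| ≤ 1 / 2)
    (hx : x ∈ strip p q l r) (hx' : x' ∈ strip p q l r) (hx₀ : x ∈ strip p q l₀ r)
    (hx₀' : x' ∈ strip p q l₀ r) (hz : z ∈ strip p q l (2 * r)) :
    z ∈ strip p q l₀ (16 * D * r / dist x x') := by
  have hd0 : 0 < dist x x' := by linarith
  simp only [strip, mem_ofPred_eq] at *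
  have h1 : |q x - q x'| ≤ 1 / 2 * |p x - p x'| + 2 * r := by
    calc |q x - q x'| = |l.1 * (p x - p x') + ((q x - l.1 * p x - l.2) -
          (q x' - l.1 * p x' - l.2))| := by congr 1; ring
      _ ≤ |l.1 * (p x - p x')| + (|q x - l.1 * p x - l.2| + |q x' - l.1 * p x' - l.2|) :=
          (abs_add_le _ _).trans (by gcongr; exact abs_sub _ _)
      _ ≤ 1 / 2 * |p x - p x'| + (r + r) := by rw [abs_mul]; gcongr
      _ = _ := by ring
  have h2 : dist x x' / 3 ≤ |p x - p x'| := by linarith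
  have h3 : |l.1 - l₀.1| * |p x - p x'| ≤ 4 * r := by
    rw [← abs_mul]
    calc _ = |((q x - l₀.1 * p x - l₀.2) - (q x' - l₀.1 * p x' - l₀.2)) -
          ((q x - l.1 * p x - l.2) - (q x' - l.1 * p x' - l.2))| := by congr 1; ring
      _ ≤ (r + r) + (r + r) := (abs_sub _ _).trans (add_le_add
          ((abs_sub _ _).trans (add_le_add hx₀ hx₀')) ((abs_sub _ _).trans (add_le_add hx hx')))
      _ = _ := by ring
  have h4 : |l.1 - l₀.1| ≤ 12 * r / dist x x' := by
    rw [le_div_iff₀ hd0]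
    nlinarith [abs_nonneg (l.1 - l₀.1)]
  have h5 : 4 * r ≤ 4 * D * r / dist x x' := by
    rw [le_div_iff₀ hd0]
    nlinarith
  calc _ = |(q z - l.1 * p z - l.2) + ((q x - l₀.1 * p x - l₀.2) - (q x - l.1 * p x - l.2)) +
        (l.1 - l₀.1) * (p z - p x)| := by congr 1; ring
    _ ≤ 2 * r + (r + r) + 12 * r / dist x x' * D := by
        refine (abs_add_le _ _).trans (add_le_add ((abs_add_le _ _).trans
          (add_le_add hz ((abs_sub _ _).trans (add_le_add hx₀ hx)))) ?_)
        rw [abs_mul, abs_of_nonneg hz0]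
        gcongr
    _ = 4 * r + 12 * r / dist x x' * D := by ring
    _ ≤ 4 * D * r / dist x x' + 12 * r / dist x x' * D := by gcongr
    _ = _ := by ring

variable [MeasurableSpace α] {μ ν : Measure α}

theorem volume_heavyLines_inter_le (h : IsTransversal p q X Y δ D) [IsFiniteMeasure ν]
    (hν : ν univ ≤ 1)
    (hνY : ∀ᵐ z ∂ν, z ∈ Y) (hp : Measurable p) (hq : Measurable q)
    (hdist : ∀ z z', dist z z' ≤ |p z - p z'| + |q z - q z'|) (hK : 1 ≤ K) (hr : 0 < r)
    (hs0 : 0 ≤ s) (hsσ : s ≤ σ) (hσ1 : σ < 1) {x x' : α} (hx : x ∈ X) (hx' : x' ∈ X) :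
    volume (heavyLines p q ν K r σ ∩ {l | x ∈ strip p q l r ∧ x' ∈ strip p q l r}) ≤
      ENNReal.ofReal (2048 * D / δ * r ^ (2 + s - σ)) * edist x x' ^ (-s) := by
  set Λ := heavyLines p q ν K r σ ∩ {l | x ∈ strip p q l r ∧ x' ∈ strip p q l r} with hΛ
  have hδ := h.pos
  have hD := h.one_le
  have hσ0 := hs0.trans hsσ
  have hm : MeasurableSet Λ := by
    refine (measurableSet_heavyLines hp hq).inter ?_
    simp only [strip, mem_ofPred_eq, ofPred_and]
    exact (measurableSet_le (by fun_prop) (by fun_prop)).inter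
      (measurableSet_le (by fun_prop) (by fun_prop))
  rcases Λ.eq_empty_or_nonempty with he | ⟨l₀, hl₀⟩
  · simp [he]
  have hslice (z : α) (hz : z ∈ Y) : volume (Λ ∩ {l | z ∈ strip p q l (2 * r)}) ≤
      ENNReal.ofReal (32 * r ^ 2 / δ) := by
    calc _ ≤ volume {l | x ∈ strip p q l (2 * r) ∧ z ∈ strip p q l (2 * r)} :=
          measure_mono fun l hl => ⟨strip_mono (by linarith) hl.1.2.1, hl.2⟩
      _ ≤ ENNReal.ofReal (8 * (2 * r) ^ 2 / δ) :=
          volume_setOf_mem_strip_le hδ (h.le_sub x hx z hz) (by positivity)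
      _ = _ := by congr 1; ring
  have hlow : ENNReal.ofReal (K * r ^ σ) * volume Λ ≤
      ∫⁻ z, volume (Λ ∩ {l | z ∈ strip p q l (2 * r)}) ∂ν := by
    rw [← setLIntegral_const, ← setLIntegral_measure_strip hp hq]
    exact setLIntegral_mono' hm fun l hl => hl.1.2.1
  suffices H : ∫⁻ z, volume (Λ ∩ {l | z ∈ strip p q l (2 * r)}) ∂ν ≤
      ENNReal.ofReal (K * r ^ σ) *
        (ENNReal.ofReal (2048 * D / δ * r ^ (2 + s - σ)) * edist x x' ^ (-s)) by
    exact (ENNReal.mul_le_mul_iff_right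
      (by simp only [ne_eq, ENNReal.ofReal_eq_zero, not_le]; positivity)
      ENNReal.ofReal_ne_top).1 (hlow.trans H)
  rw [← mul_assoc, ← ENNReal.ofReal_mul (by positivity)]
  have hpow : r ^ σ * r ^ (2 + s - σ) = r ^ 2 * r ^ s := by
    rw [← Real.rpow_add hr, ← Real.rpow_natCast, ← Real.rpow_add hr]
    congr 1; push_cast; ring
  rcases le_or_gt (4 * r) (dist x x') with hd | hd
  · have hd0 : 0 < dist x x' := by linarith
    have hdD := h.dist_le x hx x' hx'
    set ρ := 16 * D * r / dist x x' with hρ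
    have hρr : r ≤ ρ := by
      rw [hρ, le_div_iff₀ hd0]
      nlinarith
    calc ∫⁻ z, volume (Λ ∩ {l | z ∈ strip p q l (2 * r)}) ∂ν
        ≤ ∫⁻ z, (strip p q l₀ ρ).indicator (fun _ => ENNReal.ofReal (32 * r ^ 2 / δ)) z ∂ν := by
          refine lintegral_mono_ae (hνY.mono fun z hz => ?_)
          by_cases hzl : z ∈ strip p q l₀ ρ
          · rw [indicator_of_mem hzl]
            exact hslice z hz
          · rw [indicator_of_notMem hzl, nonpos_iff_eq_zero]
            convert measure_empty (μ := (volume : Measure (ℝ × ℝ)))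
            refine eq_empty_of_forall_notMem fun l hl => hzl ?_
            exact mem_strip_of_mem_strip (hdist _ _) hr hd hdD
              (hδ.le.trans (h.le_sub x hx z hz)) (h.sub_le x hx z hz) hl.1.1.1 hl.1.2.1 hl.1.2.2
              hl₀.2.1 hl₀.2.2 hl.2
      _ = ENNReal.ofReal (32 * r ^ 2 / δ) * ν (strip p q l₀ ρ) := by
          rw [lintegral_indicator_const (measurableSet_strip hp hq _ _)]
      _ ≤ ENNReal.ofReal (32 * r ^ 2 / δ) * ENNReal.ofReal (4 * K * ρ ^ σ) := by
          gcongr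
          exact measure_strip_le_of_mem_heavyLines hν hK hr hσ0 hσ1.le hl₀.1 hρr
      _ = ENNReal.ofReal (32 * r ^ 2 / δ * (4 * K * ρ ^ σ)) :=
          (ENNReal.ofReal_mul (by positivity)).symm
      _ ≤ ENNReal.ofReal (K * r ^ σ * (2048 * D / δ * r ^ (2 + s - σ)) * dist x x' ^ (-s)) := by
          refine ENNReal.ofReal_le_ofReal ?_
          have h1 : ρ ^ σ ≤ 16 * D * (r ^ s * dist x x' ^ (-s)) := by
            calc ρ ^ σ = (16 * D) ^ σ * (r / dist x x') ^ σ := by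
                  rw [hρ, mul_div_assoc, Real.mul_rpow (by positivity) (by positivity)]
              _ ≤ (16 * D) * (r / dist x x') ^ s := by
                  gcongr ?_ * ?_
                  · exact Real.rpow_le_self_of_one_le (by linarith) hσ1.le
                  · exact Real.rpow_le_rpow_of_exponent_ge (by positivity)
                      (by rw [div_le_one hd0]; linarith) hsσ
              _ = _ := by
                  rw [Real.div_rpow hr.le hd0.le, Real.rpow_neg hd0.le, div_eq_mul_inv]
          calc _ ≤ 32 * r ^ 2 / δ * (4 * K * (16 * D * (r ^ s * dist x x' ^ (-s)))) := by gcongr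
            _ = K * (2048 * D / δ) * (r ^ 2 * r ^ s) * dist x x' ^ (-s) := by ring
            _ = _ := by rw [← hpow]; ring
      _ = _ := by
          rw [ENNReal.ofReal_mul (by positivity), edist_dist, ENNReal.ofReal_rpow_of_pos hd0]
  · calc ∫⁻ z, volume (Λ ∩ {l | z ∈ strip p q l (2 * r)}) ∂ν
        ≤ ∫⁻ z, ENNReal.ofReal (32 * r ^ 2 / δ) ∂ν :=
          lintegral_mono_ae (hνY.mono hslice)
      _ ≤ ENNReal.ofReal (32 * r ^ 2 / δ) * 1 := by
          rw [lintegral_const]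
          gcongr
      _ ≤ ENNReal.ofReal (K * r ^ σ * (2048 * D / δ * r ^ (2 + s - σ)) * (4 * r) ^ (-s)) := by
          rw [mul_one]
          refine ENNReal.ofReal_le_ofReal ?_
          have h4 : (4 : ℝ) ^ s ≤ 4 :=
            Real.rpow_le_self_of_one_le (by norm_num) (hsσ.trans hσ1.le)
          calc 32 * r ^ 2 / δ = 1 * (128 * 1 / δ) * r ^ 2 * 4⁻¹ := by ring
            _ ≤ K * (2048 * D / δ) * r ^ 2 * (4 ^ s)⁻¹ := by
                gcongr; norm_num
            _ = K * (2048 * D / δ) * (r ^ σ * r ^ (2 + s - σ)) * (4 * r) ^ (-s) := by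
                rw [hpow, Real.rpow_neg (by positivity), Real.mul_rpow (by norm_num) hr.le]
                field_simp
            _ = _ := by ring
      _ ≤ _ := by
          rw [ENNReal.ofReal_mul (by positivity)]
          gcongr
          rw [← ENNReal.ofReal_rpow_of_pos (by positivity), ENNReal.rpow_neg, ENNReal.rpow_neg,
            ENNReal.inv_le_inv, edist_dist]
          gcongr

end Transversal

/-- The line through `x` and `y` in the coordinates `p`, `q`, as a pair of slope and intercept. -/
def joinLine {α : Type*} (p q : α → ℝ) (x y : α) : ℝ × ℝ :=
  ((q y - q x) / (p y - p x), q x - (q y - q x) / (p y - p x) * p x)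

/-- The pairs whose joining line has a `ν`-heavy `r`-strip, `r` being the coarsest such scale. -/
def heavyPairs {α : Type*} [MeasurableSpace α] (p q : α → ℝ) (ν : Measure α) (K r σ : ℝ) :
    Set (α × α) :=
  {w | ENNReal.ofReal (K * r ^ σ) < ν (strip p q (joinLine p q w.1 w.2) r) ∧
    ∀ j : ℕ, r < (1 / 2) ^ j →
      ν (strip p q (joinLine p q w.1 w.2) ((1 / 2) ^ j)) ≤ ENNReal.ofReal (K * ((1 / 2) ^ j) ^ σ)}

section ThinPairs

variable {α : Type*} {p q : α → ℝ} {X Y : Set α} {δ D K r s t σ : ℝ}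

theorem mem_strip_joinLine_iff {x y z : α} {ρ : ℝ} : z ∈ strip p q (joinLine p q x y) ρ ↔
    |(q z - q x) - (q y - q x) / (p y - p x) * (p z - p x)| ≤ ρ := by
  simp only [strip, joinLine, mem_ofPred_eq]
  ring_nf

variable [MeasurableSpace α] {μ ν : Measure α}

theorem measurable_measure_strip_joinLine [SFinite ν] (hp : Measurable p) (hq : Measurable q)
    (r : ℝ) : Measurable fun w : α × α => ν (strip p q (joinLine p q w.1 w.2) r) := by
  refine (measurable_measure_strip hp hq ν r).comp (g := fun l => ν (strip p q l r))
    (f := fun w : α × α => joinLine p q w.1 w.2) ?_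
  unfold joinLine
  fun_prop

theorem measurableSet_heavyPairs [SFinite ν] (hp : Measurable p) (hq : Measurable q) :
    MeasurableSet (heavyPairs p q ν K r σ) := by
  have h := measurable_measure_strip_joinLine (ν := ν) hp hq
  simp only [heavyPairs, ofPred_and, ofPred_forall]
  exact (measurableSet_lt measurable_const (h _)).inter
    (MeasurableSet.iInter fun j => MeasurableSet.iInter fun _ =>
      measurableSet_le (h _) measurable_const)

variable [PseudoMetricSpace α]

theorem mem_heavyLines_of_mem_heavyPairs (h : IsTransversal p q X Y δ D) (hνY : ∀ᵐ z ∂ν, z ∈ Y)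
    (hr : 0 < r) (hr2 : r ≤ 1 / 2) {x y : α} (hx : x ∈ X) (hy : y ∈ Y)
    (hxy : (x, y) ∈ heavyPairs p q ν K r σ) {l : ℝ × ℝ}
    (hl₁ : |l.1 - (q y - q x) / (p y - p x)| ≤ r / (2 * D))
    (hl₂ : |l.2 - (q x - l.1 * p x)| ≤ r / 2) :
    l ∈ heavyLines p q ν K r σ ∩ {l | x ∈ strip p q l r ∧ y ∈ strip p q l r} := by
  have hD := h.one_le
  have hpos : 0 < p y - p x := h.pos.trans_le (h.le_sub x hx y hy)
  have hclose (z : α) (hz : z ∈ Y) : |(q z - l.1 * p z - l.2) -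
      ((q z - q x) - (q y - q x) / (p y - p x) * (p z - p x))| ≤ r := by
    calc _ = |(l.1 - (q y - q x) / (p y - p x)) * (p z - p x) + (l.2 - (q x - l.1 * p x))| := by
          rw [← abs_neg]; congr 1; ring
      _ ≤ r / (2 * D) * D + r / 2 := by
          refine (abs_add_le _ _).trans (add_le_add ?_ hl₂)
          rw [abs_mul, abs_of_pos (h.pos.trans_le (h.le_sub x hx z hz))]
          exact mul_le_mul hl₁ (h.sub_le x hx z hz)
            (h.pos.trans_le (h.le_sub x hx z hz)).le (by positivity)
      _ = r := by field_simp; ring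
  refine ⟨⟨?_, ?_, fun j hj => ?_⟩, ?_, ?_⟩
  · have h1 : |(q y - q x) / (p y - p x)| ≤ 1 / 4 := by
      rw [abs_div, abs_of_pos hpos, div_le_iff₀ hpos]
      linarith [h.abs_sub_le x hx y hy]
    have h2 : r / (2 * D) ≤ 1 / 4 := by
      rw [div_le_iff₀ (by positivity)]
      linarith
    calc |l.1| = |(l.1 - (q y - q x) / (p y - p x)) + (q y - q x) / (p y - p x)| := by
          congr 1; ring
      _ ≤ 1 / 4 + 1 / 4 := (abs_add_le _ _).trans (add_le_add (hl₁.trans h2) h1)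
      _ = 1 / 2 := by norm_num
  · refine hxy.1.le.trans (measure_mono_ae (hνY.mono fun z hz hzs => ?_))
    have hzs' := mem_strip_joinLine_iff.1 hzs
    have := abs_add_le ((q z - l.1 * p z - l.2) -
      ((q z - q x) - (q y - q x) / (p y - p x) * (p z - p x)))
      ((q z - q x) - (q y - q x) / (p y - p x) * (p z - p x))
    rw [sub_add_cancel] at this
    change |q z - l.1 * p z - l.2| ≤ 2 * r
    linarith [hclose z hz]
  · have h2 : (1 / 2 : ℝ) ^ j = 2 * (1 / 2) ^ (j + 1) := by rw [pow_succ]; ring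
    refine le_trans (measure_mono_ae (hνY.mono fun z hz hzs => ?_)) (hxy.2 j (by linarith))
    refine mem_strip_joinLine_iff.2 ?_
    have hzs' : |q z - l.1 * p z - l.2| ≤ (1 / 2) ^ (j + 1) := hzs
    have := abs_sub (q z - l.1 * p z - l.2) ((q z - l.1 * p z - l.2) -
      ((q z - q x) - (q y - q x) / (p y - p x) * (p z - p x)))
    rw [sub_sub_cancel] at this
    linarith [hclose z hz]
  · have h4 : q x - l.1 * p x - l.2 = -(l.2 - (q x - l.1 * p x)) := by ring
    change |q x - l.1 * p x - l.2| ≤ r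
    rw [h4, abs_neg]
    linarith
  · have := hclose y hy
    rwa [div_mul_cancel₀ _ hpos.ne', sub_self, sub_zero] at this

theorem measure_heavyPairs_le_setLIntegral (h : IsTransversal p q X Y δ D) [SFinite μ]
    [SFinite ν] (hp : Measurable p) (hq : Measurable q) (hμX : ∀ᵐ z ∂μ, z ∈ X)
    (hνY : ∀ᵐ z ∂ν, z ∈ Y) (hr : 0 < r) (hr2 : r ≤ 1 / 2) :
    ENNReal.ofReal (r ^ 2 / D) * (μ.prod ν) (heavyPairs p q ν K r σ) ≤
      ∫⁻ l in heavyLines p q ν K r σ, μ (strip p q l r) * ν (strip p q l r) := by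
  have hD := h.one_le
  rw [setLIntegral_measure_strip_mul hp hq, ← setLIntegral_const]
  refine (setLIntegral_mono_ae' (measurableSet_heavyPairs hp hq) ?_).trans
    (setLIntegral_le_lintegral _ _)
  filter_upwards [Measure.quasiMeasurePreserving_fst.ae hμX,
    Measure.quasiMeasurePreserving_snd.ae hνY] with w hw₁ hw₂ hw
  calc ENNReal.ofReal (r ^ 2 / D) = ENNReal.ofReal (2 * (r / 2)) *
        ENNReal.ofReal (2 * (r / (2 * D))) := by
        rw [← ENNReal.ofReal_mul (by positivity)]; congr 1; field_simp
    _ = _ := (volume_slab (f := fun m => q w.1 - m * p w.1) (by fun_prop)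
        ((q w.2 - q w.1) / (p w.2 - p w.1)) _ _).symm
    _ ≤ _ := measure_mono fun l hl =>
        mem_heavyLines_of_mem_heavyPairs h hνY hr hr2 hw₁ hw₂ hw hl.1 hl.2

theorem setLIntegral_heavyLines_sq_le (h : IsTransversal p q X Y δ D) [SFinite μ]
    [IsFiniteMeasure ν] (hν : ν univ ≤ 1) (hμX : ∀ᵐ z ∂μ, z ∈ X) (hνY : ∀ᵐ z ∂ν, z ∈ Y)
    (hp : Measurable p) (hq : Measurable q)
    (hdist : ∀ z z', dist z z' ≤ |p z - p z'| + |q z - q z'|) (hK : 1 ≤ K) (hr : 0 < r)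
    (hs0 : 0 ≤ s) (hsσ : s ≤ σ) (hσ1 : σ < 1) :
    ∫⁻ l in heavyLines p q ν K r σ, μ (strip p q l r) * μ (strip p q l r) ≤
      ENNReal.ofReal (2048 * D / δ * r ^ (2 + s - σ)) *
        ∫⁻ x : α × α, edist x.1 x.2 ^ (-s) ∂(μ.prod μ) := by
  rw [setLIntegral_measure_strip_mul hp hq, ← lintegral_const_mul' _ _ ENNReal.ofReal_ne_top]
  refine lintegral_mono_ae ?_
  filter_upwards [Measure.quasiMeasurePreserving_fst.ae hμX,
    Measure.quasiMeasurePreserving_snd.ae hμX] with w hw₁ hw₂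
  exact volume_heavyLines_inter_le h hν hνY hp hq hdist hK hr hs0 hsσ hσ1 hw₁ hw₂

theorem le_add_inv_mul_mul {a c : ℝ≥0∞} (ha : a ≠ 0) (ha' : a ≠ ⊤) : c ≤ a + a⁻¹ * (c * c) := by
  rcases le_or_gt c a with h | h
  · exact h.trans le_self_add
  · calc c = a⁻¹ * (a * c) := by rw [← mul_assoc, ENNReal.inv_mul_cancel ha ha', one_mul]
      _ ≤ a⁻¹ * (c * c) := by gcongr
      _ ≤ _ := le_add_self

theorem setLIntegral_heavyLines_mul_le (h : IsTransversal p q X Y δ D) [SFinite μ]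
    [IsFiniteMeasure ν] (hν : ν univ ≤ 1) (hμX : ∀ᵐ z ∂μ, z ∈ X) (hνY : ∀ᵐ z ∂ν, z ∈ Y)
    (hp : Measurable p) (hq : Measurable q)
    (hdist : ∀ z z', dist z z' ≤ |p z - p z'| + |q z - q z'|) (hK : 1 ≤ K) (hr : 0 < r)
    (hs0 : 0 ≤ s) (hsσ : s ≤ σ) (hσ1 : σ < 1) {R : ℝ} (ht0 : 0 < t) (ht2 : t ≤ 2) (hR : 2 ≤ R)
    (hRσ : 16 * R ^ (σ - 1) ≤ 1) :
    ∫⁻ l in heavyLines p q ν K r σ, μ (strip p q l r) * ν (strip p q l r) ≤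
      ENNReal.ofReal (r ^ ((3 + s + t - σ) / 2)) *
        (ENNReal.ofReal (51200 * R ^ t) * ∫⁻ x : α × α, edist x.1 x.2 ^ (-t) ∂(ν.prod ν) +
          ENNReal.ofReal (8192 * D / δ) * ∫⁻ x : α × α, edist x.1 x.2 ^ (-s) ∂(μ.prod μ)) := by
  have hδ := h.pos
  have hD := h.one_le
  have hσ0 := hs0.trans hsσ
  have hK0 : 0 < K := by linarith
  have hR0 : 0 < R := by linarith
  have hL := measurableSet_heavyLines (ν := ν) (K := K) (r := r) (σ := σ) hp hq
  have h1 := volume_heavyLines_le (ν := ν) (K := K) hν hp hq hdist hK hr hσ0 hσ1 ht0 ht2 hR hRσ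
  have h2 := setLIntegral_heavyLines_sq_le (μ := μ) h hν hμX hνY hp hq hdist hK hr hs0 hsσ hσ1
  set It := ∫⁻ x : α × α, edist x.1 x.2 ^ (-t) ∂(ν.prod ν)
  set Is := ∫⁻ x : α × α, edist x.1 x.2 ^ (-s) ∂(μ.prod μ)
  set L := heavyLines p q ν K r σ
  set γ := (1 + s + σ - t) / 2 with hγ
  have hlam : 0 < K * r ^ γ := by positivity
  have hlam0 : ENNReal.ofReal (K * r ^ γ) ≠ 0 := by
    simpa only [ne_eq, ENNReal.ofReal_eq_zero, not_le]
  calc ∫⁻ l in L, μ (strip p q l r) * ν (strip p q l r)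
      ≤ ∫⁻ l in L, ENNReal.ofReal (4 * K * r ^ σ) * (ENNReal.ofReal (K * r ^ γ) +
          (ENNReal.ofReal (K * r ^ γ))⁻¹ * (μ (strip p q l r) * μ (strip p q l r))) := by
        refine setLIntegral_mono' hL fun l hl => ?_
        rw [mul_comm]
        exact mul_le_mul' (measure_strip_le_of_mem_heavyLines hν hK hr hσ0 hσ1.le hl le_rfl)
          (le_add_inv_mul_mul hlam0 ENNReal.ofReal_ne_top)
    _ = ENNReal.ofReal (4 * K * r ^ σ) * (ENNReal.ofReal (K * r ^ γ) * volume L +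
          (ENNReal.ofReal (K * r ^ γ))⁻¹ *
            ∫⁻ l in L, μ (strip p q l r) * μ (strip p q l r)) := by
        rw [lintegral_const_mul' _ _ ENNReal.ofReal_ne_top, lintegral_add_left measurable_const,
          setLIntegral_const, lintegral_const_mul' _ _ (ENNReal.inv_ne_top.2 hlam0)]
    _ ≤ ENNReal.ofReal (4 * K * r ^ σ) * (ENNReal.ofReal (K * r ^ γ) *
          (ENNReal.ofReal (12800 * R ^ t * K ^ (-2 : ℝ) * r ^ (1 + t - 2 * σ)) * It) +
          (ENNReal.ofReal (K * r ^ γ))⁻¹ *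
            (ENNReal.ofReal (2048 * D / δ * r ^ (2 + s - σ)) * Is)) := by gcongr
    _ = _ := by
        rw [← ENNReal.ofReal_inv_of_pos hlam, mul_add, mul_add]
        simp only [← mul_assoc]
        rw [← ENNReal.ofReal_mul (by positivity), ← ENNReal.ofReal_mul (by positivity),
          ← ENNReal.ofReal_mul (by positivity), ← ENNReal.ofReal_mul (by positivity),
          ← ENNReal.ofReal_mul (by positivity), ← ENNReal.ofReal_mul (by positivity)]
        congr 3
        · have : r ^ ((3 + s + t - σ) / 2) = r ^ σ * r ^ γ * r ^ (1 + t - 2 * σ) := by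
            rw [← Real.rpow_add hr, ← Real.rpow_add hr]
            congr 1; rw [hγ]; ring
          rw [this, Real.rpow_neg hK0.le, Real.rpow_two]
          field_simp; norm_num
        · have : r ^ ((3 + s + t - σ) / 2) = r ^ σ * r ^ (2 + s - σ) / r ^ γ := by
            rw [← Real.rpow_add hr, ← Real.rpow_sub hr]
            congr 1; rw [hγ]; ring
          rw [this]
          field_simp; norm_num

theorem measure_heavyPairs_le (h : IsTransversal p q X Y δ D) [SFinite μ]
    [IsFiniteMeasure ν] (hν : ν univ ≤ 1) (hμX : ∀ᵐ z ∂μ, z ∈ X) (hνY : ∀ᵐ z ∂ν, z ∈ Y)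
    (hp : Measurable p) (hq : Measurable q)
    (hdist : ∀ z z', dist z z' ≤ |p z - p z'| + |q z - q z'|) (hK : 1 ≤ K) (hr : 0 < r)
    (hr2 : r ≤ 1 / 2)
    (hs0 : 0 ≤ s) (hsσ : s ≤ σ) (hσ1 : σ < 1) {R : ℝ} (ht0 : 0 < t) (ht2 : t ≤ 2) (hR : 2 ≤ R)
    (hRσ : 16 * R ^ (σ - 1) ≤ 1) :
    (μ.prod ν) (heavyPairs p q ν K r σ) ≤
      ENNReal.ofReal (D * r ^ ((s + t - 1 - σ) / 2)) *
        (ENNReal.ofReal (51200 * R ^ t) * ∫⁻ x : α × α, edist x.1 x.2 ^ (-t) ∂(ν.prod ν) +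
          ENNReal.ofReal (8192 * D / δ) * ∫⁻ x : α × α, edist x.1 x.2 ^ (-s) ∂(μ.prod μ)) := by
  have hD : 0 < D := zero_lt_one.trans_le h.one_le
  have h1 := (measure_heavyPairs_le_setLIntegral (K := K) (σ := σ) h hp hq hμX hνY hr hr2).trans
    (setLIntegral_heavyLines_mul_le h hν hμX hνY hp hq hdist hK hr hs0 hsσ hσ1 ht0 ht2 hR hRσ)
  have h2 : r ^ ((3 + s + t - σ) / 2) = r ^ 2 / D * (D * r ^ ((s + t - 1 - σ) / 2)) := by
    rw [← mul_assoc, div_mul_cancel₀ _ hD.ne', ← Real.rpow_natCast r 2, ← Real.rpow_add hr]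
    congr 1; push_cast; ring
  rw [h2, ENNReal.ofReal_mul (by positivity), mul_assoc] at h1
  exact (ENNReal.mul_le_mul_iff_right
    (by simp only [ne_eq, ENNReal.ofReal_eq_zero, not_le]; positivity)
    ENNReal.ofReal_ne_top).1 h1

end ThinPairs

/-- The pairs whose joining line has thin `ν`-strips at all dyadic scales. -/
def thinPairs {α : Type*} [MeasurableSpace α] (p q : α → ℝ) (ν : Measure α) (K σ : ℝ) :
    Set (α × α) :=
  {w | ∀ k : ℕ, ν (strip p q (joinLine p q w.1 w.2) ((1 / 2) ^ k)) ≤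
    ENNReal.ofReal (K * ((1 / 2) ^ k) ^ σ)}

section ThinPairsPos

variable {α : Type*} {p q : α → ℝ} {X Y : Set α} {δ D K s t σ : ℝ}
  [MeasurableSpace α] {μ ν : Measure α}

theorem measurableSet_thinPairs [SFinite ν] (hp : Measurable p) (hq : Measurable q) :
    MeasurableSet (thinPairs p q ν K σ) := by
  simp only [thinPairs, ofPred_forall]
  exact MeasurableSet.iInter fun k =>
    measurableSet_le (measurable_measure_strip_joinLine hp hq _) measurable_const

theorem compl_thinPairs_subset (hν : ν univ ≤ 1) {k₀ : ℕ} (hσ0 : 0 ≤ σ)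
    (hK : K = ((1 / 2 : ℝ) ^ k₀) ^ (-σ)) :
    (thinPairs p q ν K σ)ᶜ ⊆ ⋃ k : ℕ, heavyPairs p q ν K ((1 / 2) ^ (k + k₀)) σ := by
  classical
  intro w hw
  have hex : ∃ k : ℕ, ENNReal.ofReal (K * ((1 / 2) ^ k) ^ σ) <
      ν (strip p q (joinLine p q w.1 w.2) ((1 / 2) ^ k)) := by
    by_contra! hc
    exact hw hc
  have hk := Nat.find_spec hex
  have hmin : ∀ j < Nat.find hex, _ := fun j hj => Nat.find_min hex hj
  set k := Nat.find hex
  have hk₀ : k₀ ≤ k := by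
    by_contra! hlt
    refine hk.not_ge ((measure_mono (subset_univ _)).trans (hν.trans ?_))
    rw [← ENNReal.ofReal_one]
    refine ENNReal.ofReal_le_ofReal ?_
    rw [hK, Real.rpow_neg (by positivity), inv_mul_eq_div, one_le_div (by positivity)]
    exact Real.rpow_le_rpow (by positivity)
      (pow_le_pow_of_le_one (by norm_num) (by norm_num) hlt.le) hσ0
  refine mem_iUnion.2 ⟨k - k₀, ?_⟩
  rw [Nat.sub_add_cancel hk₀]
  refine ⟨hk, fun j hj => ?_⟩
  have hjk : j < k := by
    by_contra! hle
    exact hj.not_ge (pow_le_pow_of_le_one (by norm_num) (by norm_num) hle)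
  exact not_lt.1 (hmin j hjk)

theorem exists_two_le_rpow (hσ1 : σ < 1) : ∃ R : ℝ, 2 ≤ R ∧ 16 * R ^ (σ - 1) ≤ 1 := by
  have h := (tendsto_rpow_neg_atTop (sub_pos.2 hσ1)).eventually
    (ge_mem_nhds (by norm_num : (0 : ℝ) < 1 / 16))
  obtain ⟨R, hR, hR2⟩ := (h.and (Filter.eventually_ge_atTop 2)).exists
  refine ⟨R, hR2, ?_⟩
  rw [neg_sub] at hR
  linarith

theorem exists_measure_thinPairs_pos [PseudoMetricSpace α] (h : IsTransversal p q X Y δ D)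
    [IsFiniteMeasure μ] [IsFiniteMeasure ν] (hμ0 : μ ≠ 0) (hν0 : ν ≠ 0) (hν : ν univ ≤ 1)
    (hμX : ∀ᵐ z ∂μ, z ∈ X) (hνY : ∀ᵐ z ∂ν, z ∈ Y) (hp : Measurable p) (hq : Measurable q)
    (hdist : ∀ z z', dist z z' ≤ |p z - p z'| + |q z - q z'|)
    (hs0 : 0 ≤ s) (hsσ : s ≤ σ) (hσ1 : σ < 1) (ht0 : 0 < t) (ht2 : t ≤ 2) (hσ : σ < s + t - 1)
    (hIt : ∫⁻ x : α × α, edist x.1 x.2 ^ (-t) ∂(ν.prod ν) ≠ ⊤)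
    (hIs : ∫⁻ x : α × α, edist x.1 x.2 ^ (-s) ∂(μ.prod μ) ≠ ⊤) :
    ∃ K : ℝ, 0 < K ∧ 0 < (μ.prod ν) (thinPairs p q ν K σ) := by
  obtain ⟨R, hR, hRσ⟩ := exists_two_le_rpow hσ1
  have hD : 0 < D := zero_lt_one.trans_le h.one_le
  set η := (s + t - 1 - σ) / 2 with hη
  have hη0 : 0 < η := by rw [hη]; linarith
  set M := ENNReal.ofReal (51200 * R ^ t) * ∫⁻ x : α × α, edist x.1 x.2 ^ (-t) ∂(ν.prod ν) +
    ENNReal.ofReal (8192 * D / δ) * ∫⁻ x : α × α, edist x.1 x.2 ^ (-s) ∂(μ.prod μ) with hM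
  have hM' : M ≠ ⊤ := ENNReal.add_ne_top.2 ⟨ENNReal.mul_ne_top ENNReal.ofReal_ne_top hIt,
    ENNReal.mul_ne_top ENNReal.ofReal_ne_top hIs⟩
  have hle (k₀ k : ℕ) : (μ.prod ν) (heavyPairs p q ν (((1 / 2 : ℝ) ^ (k₀ + 1)) ^ (-σ))
      ((1 / 2) ^ (k + (k₀ + 1))) σ) ≤
      ENNReal.ofReal (D * ((1 / 2) ^ η) ^ (k + (k₀ + 1))) * M := by
    have h1 : (1 / 2 : ℝ) ^ (k + (k₀ + 1)) ≤ 1 / 2 :=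
      (pow_le_pow_of_le_one (by norm_num) (by norm_num) (show 1 ≤ k + (k₀ + 1) by omega)).trans
        (pow_one _).le
    refine (measure_heavyPairs_le h hν hμX hνY hp hq hdist ?_ (by positivity) h1 hs0 hsσ hσ1
      ht0 ht2 hR hRσ).trans_eq ?_
    · exact Real.one_le_rpow_of_pos_of_le_one_of_nonpos (by positivity)
        (pow_le_one₀ (by norm_num) (by norm_num)) (by linarith)
    · rw [Real.rpow_pow_comm (by norm_num)]
  have hsum : ∑' k : ℕ, ENNReal.ofReal (D * ((1 / 2) ^ η) ^ k) * M ≠ ⊤ := by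
    rw [ENNReal.tsum_mul_right]
    refine ENNReal.mul_ne_top ?_ hM'
    exact ((summable_geometric_of_lt_one (by positivity)
      (Real.rpow_lt_one (by norm_num) (by norm_num) hη0)).mul_left D).tsum_ofReal_ne_top
  have htend := (ENNReal.tendsto_sum_nat_add _ hsum).comp (Filter.tendsto_add_atTop_nat 1)
  have hpos : 0 < (μ.prod ν) univ := by
    rw [Measure.measure_univ_pos, ne_eq, ← Measure.measure_univ_eq_zero, ← univ_prod_univ,
      Measure.prod_prod]
    simp [hμ0, hν0]
  obtain ⟨k₀, hk₀⟩ := (htend.eventually (gt_mem_nhds hpos)).exists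
  refine ⟨((1 / 2 : ℝ) ^ (k₀ + 1)) ^ (-σ), by positivity, ?_⟩
  have hcompl : (μ.prod ν) (thinPairs p q ν (((1 / 2 : ℝ) ^ (k₀ + 1)) ^ (-σ)) σ)ᶜ <
      (μ.prod ν) univ :=
    ((measure_mono (compl_thinPairs_subset hν (hs0.trans hsσ) rfl)).trans
      ((measure_iUnion_le _).trans (ENNReal.tsum_le_tsum (hle k₀)))).trans_lt hk₀
  rw [pos_iff_ne_zero]
  intro h0
  rw [← measure_add_measure_compl (measurableSet_thinPairs (ν := ν) hp hq), h0, zero_add] at hcompl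
  exact lt_irrefl _ hcompl

end ThinPairsPos

theorem msupport_eq_support {E : Type*} [PseudoMetricSpace E] [MeasurableSpace E]
    (μ : Measure E) : msupport μ = μ.support := by
  ext x
  exact (nhds_basis_ball.mem_measureSupport).symm

section Energy

variable {E : Type*} [PseudoMetricSpace E] [MeasurableSpace E] {μ : Measure E} {s t : ℝ}

theorem energy_lt_top_of_le [IsProbabilityMeasure μ] (hst : s ≤ t) (hs0 : 0 ≤ s)
    (h : energy μ t < ⊤) : energy μ s < ⊤ := by
  have hle (x y : E) : edist x y ^ (-s) ≤ 1 + edist x y ^ (-t) := by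
    rcases le_total (edist x y) 1 with h1 | h1
    · exact (ENNReal.rpow_le_rpow_of_exponent_ge h1 (neg_le_neg hst)).trans le_add_self
    · refine le_trans ?_ le_self_add
      rw [ENNReal.rpow_neg, ENNReal.inv_le_one]
      simpa using ENNReal.rpow_le_rpow h1 hs0
  calc energy μ s ≤ ∫⁻ x, ∫⁻ y, (1 + edist x y ^ (-t)) ∂μ ∂μ :=
        lintegral_mono fun x => lintegral_mono fun y => hle x y
    _ = 1 + energy μ t := by
        simp_rw [lintegral_add_left measurable_const]
        simp [energy]
    _ < ⊤ := by simp [h]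

theorem measure_singleton_eq_zero_of_energy [MeasurableSingletonClass E] (ht : 0 < t)
    (h : energy μ t < ⊤) (x₀ : E) : μ {x₀} = 0 := by
  by_contra h0
  refine h.not_ge ?_
  calc (⊤ : ℝ≥0∞) = ∫⁻ x in {x₀}, ∫⁻ y in {x₀}, edist x y ^ (-t) ∂μ ∂μ := by
        simp [ENNReal.zero_rpow_of_neg (neg_lt_zero.2 ht), ENNReal.mul_top h0]
    _ ≤ ∫⁻ x in {x₀}, ∫⁻ y, edist x y ^ (-t) ∂μ ∂μ :=
        lintegral_mono fun x => setLIntegral_le_lintegral _ _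
    _ ≤ energy μ t := setLIntegral_le_lintegral _ _

theorem lintegral_edist_restrict_prod_le [SFinite μ] (X : Set E) :
    ∫⁻ x : E × E, edist x.1 x.2 ^ (-s) ∂((μ.restrict X).prod (μ.restrict X)) ≤ energy μ s := by
  rw [Measure.prod_restrict]
  exact (setLIntegral_le_lintegral _ _).trans (lintegral_prod_le _)

end Energy

/-- Linear coordinates `p`, `q` that are orthonormal on `E2`. -/
structure IsOrthoCoord (p q : E2 →L[ℝ] ℝ) : Prop where
  norm_sq : ∀ z, ‖z‖ ^ 2 = p z ^ 2 + q z ^ 2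

namespace IsOrthoCoord

variable {p q : E2 →L[ℝ] ℝ}

theorem abs_fst_le (h : IsOrthoCoord p q) (z : E2) : |p z| ≤ ‖z‖ :=
  abs_le_of_sq_le_sq (by nlinarith [h.norm_sq z, sq_nonneg (q z)]) (norm_nonneg z)

theorem abs_snd_le (h : IsOrthoCoord p q) (z : E2) : |q z| ≤ ‖z‖ :=
  abs_le_of_sq_le_sq (by nlinarith [h.norm_sq z, sq_nonneg (p z)]) (norm_nonneg z)

theorem norm_le (h : IsOrthoCoord p q) (z : E2) : ‖z‖ ≤ |p z| + |q z| := by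
  refine le_of_sq_le_sq ?_ (by positivity)
  rw [h.norm_sq, add_sq, sq_abs, sq_abs]
  nlinarith [mul_nonneg (abs_nonneg (p z)) (abs_nonneg (q z))]

theorem dist_le (h : IsOrthoCoord p q) (z z' : E2) :
    dist z z' ≤ |p z - p z'| + |q z - q z'| := by
  rw [dist_eq_norm, ← map_sub, ← map_sub]
  exact h.norm_le _

end IsOrthoCoord

theorem exists_isOrthoCoord {u : E2} (hu : u ≠ 0) :
    ∃ p q : E2 →L[ℝ] ℝ, IsOrthoCoord p q ∧ p u = ‖u‖ ∧ q u = 0 := by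
  have hu0 : ‖u‖ ≠ 0 := norm_ne_zero_iff.2 hu
  have hn (z : E2) : ‖z‖ ^ 2 = z 0 ^ 2 + z 1 ^ 2 := by
    simp [EuclideanSpace.norm_sq_eq, Fin.sum_univ_two]
  let P (i : Fin 2) : E2 →L[ℝ] ℝ := EuclideanSpace.proj i
  refine ⟨‖u‖⁻¹ • (u 0 • P 0 + u 1 • P 1), ‖u‖⁻¹ • (u 0 • P 1 - u 1 • P 0), ⟨fun z => ?_⟩, ?_, ?_⟩
  · have h1 : ‖u‖⁻¹ ^ 2 * (u 0 ^ 2 + u 1 ^ 2) = 1 := by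
      rw [← hn, ← mul_pow, inv_mul_cancel₀ hu0, one_pow]
    rw [hn]
    simp [P]
    linear_combination -(z 0 ^ 2 + z 1 ^ 2) * h1
  · have h1 := hn u
    simp [P]
    field_simp
    linear_combination -h1
  · simp [P]; right; ring

theorem isTransversal_closedBall {p q : E2 →L[ℝ] ℝ} (h : IsOrthoCoord p q) {x₀ y₀ : E2}
    (hxy : x₀ ≠ y₀) (hp : p (y₀ - x₀) = ‖y₀ - x₀‖) (hq : q (y₀ - x₀) = 0) {d : ℝ}
    (hd : d = ‖y₀ - x₀‖ / 10) :
    IsTransversal p q (closedBall x₀ d) (closedBall y₀ d) (5 * d) (12 * d + 1) := by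
  have h0 : 0 < d := by
    have := norm_pos_iff.2 (sub_ne_zero.2 hxy.symm)
    rw [hd]; positivity
  have key {x y : E2} (hx : x ∈ closedBall x₀ d) (hy : y ∈ closedBall y₀ d) :
      |p y - p x - 10 * d| ≤ 2 * d ∧ |q y - q x| ≤ 2 * d := by
    have hx' : ‖x - x₀‖ ≤ d := by rwa [← dist_eq_norm]
    have hy' : ‖y - y₀‖ ≤ d := by rwa [← dist_eq_norm]
    have e1 : p y - p x - 10 * d = p (y - y₀) - p (x - x₀) := by
      simp only [map_sub] at hp ⊢; linarith
    have e2 : q y - q x = q (y - y₀) - q (x - x₀) := by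
      simp only [map_sub] at hq ⊢; linarith
    rw [e1, e2]
    constructor
    · linarith [abs_sub (p (y - y₀)) (p (x - x₀)), h.abs_fst_le (y - y₀), h.abs_fst_le (x - x₀)]
    · linarith [abs_sub (q (y - y₀)) (q (x - x₀)), h.abs_snd_le (y - y₀), h.abs_snd_le (x - x₀)]
  refine ⟨by positivity, by linarith, fun x hx y hy => ?_, fun x hx y hy => ?_, fun x hx y hy => ?_,
    fun x hx x' hx' => ?_⟩
  · linarith [abs_le.1 (key hx hy).1]
  · linarith [abs_le.1 (key hx hy).1]
  · linarith [abs_le.1 (key hx hy).1, (key hx hy).2]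
  · linarith [dist_triangle_right x x' x₀, mem_closedBall.1 hx, mem_closedBall.1 hx']

theorem IsTransversal.mono {α : Type*} [PseudoMetricSpace α] {p q : α → ℝ} {X Y X' Y' : Set α}
    {δ D : ℝ} (h : IsTransversal p q X Y δ D) (hX : X' ⊆ X) (hY : Y' ⊆ Y) :
    IsTransversal p q X' Y' δ D :=
  ⟨h.pos, h.one_le, fun x hx y hy => h.le_sub x (hX hx) y (hY hy),
    fun x hx y hy => h.sub_le x (hX hx) y (hY hy),
    fun x hx y hy => h.abs_sub_le x (hX hx) y (hY hy),
    fun x hx x' hx' => h.dist_le x (hX hx) x' (hX hx')⟩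

theorem exists_eq_add_of_mem_cthickening {E : Type*} [NormedAddCommGroup E] [NormedSpace ℝ E]
    {a v z : E} {r : ℝ} (hr : 0 < r) (hz : z ∈ cthickening r {p | ∃ t : ℝ, p = a + t • v}) :
    ∃ (t : ℝ) (w : E), ‖w‖ ≤ 2 * r ∧ z = a + t • v + w := by
  have h := cthickening_subset_thickening' (by positivity : 0 < 2 * r) (by linarith) _ hz
  obtain ⟨_, ⟨t, rfl⟩, h2⟩ := mem_thickening_iff.1 h
  refine ⟨t, z - (a + t • v), ?_, by abel⟩
  rw [← dist_eq_norm]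
  exact h2.le

theorem mem_strip_joinLine_of_mem_cthickening {p q : E2 →L[ℝ] ℝ} (h : IsOrthoCoord p q)
    {X Y : Set E2} {δ D : ℝ} (hT : IsTransversal p q X Y δ D) {r : ℝ} (hr : 0 < r) (hr1 : r ≤ 1)
    {ℓ : Set E2} (hℓ : IsAffineLine ℓ) {x y z : E2} (hx : x ∈ X) (hy : y ∈ Y) (hz : z ∈ Y)
    (hxℓ : x ∈ cthickening r ℓ) (hyℓ : y ∈ cthickening r ℓ) (hzℓ : z ∈ cthickening r ℓ) :
    z ∈ strip p q (joinLine p q x y) (42 * D / δ * r) := by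
  obtain ⟨a, v, -, rfl⟩ := hℓ
  obtain ⟨t₁, w₁, hw₁, hx'⟩ := exists_eq_add_of_mem_cthickening hr hxℓ
  obtain ⟨t₂, w₂, hw₂, hy'⟩ := exists_eq_add_of_mem_cthickening hr hyℓ
  obtain ⟨t₃, w₃, hw₃, hz'⟩ := exists_eq_add_of_mem_cthickening hr hzℓ
  have hD := hT.one_le
  have hδ := hT.pos
  have hpos : 0 < p y - p x := hT.pos.trans_le (hT.le_sub x hx y hy)
  have hB {w w' : E2} (hw : ‖w‖ ≤ 2 * r) (hw' : ‖w'‖ ≤ 2 * r) :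
      |p w - p w'| ≤ 4 * r ∧ |q w - q w'| ≤ 4 * r := by
    rw [← map_sub, ← map_sub]
    have h1 : ‖w - w'‖ ≤ 4 * r := (norm_sub_le _ _).trans (by linarith)
    exact ⟨(h.abs_fst_le _).trans h1, (h.abs_snd_le _).trans h1⟩
  obtain ⟨b1, b2⟩ := hB hw₂ hw₁
  obtain ⟨b3, b4⟩ := hB hw₃ hw₁
  have hA {z : E2} (hz : z ∈ Y) : |p z - p x| ≤ D ∧ |q z - q x| ≤ D / 4 := by
    rw [abs_of_pos (hT.pos.trans_le (hT.le_sub x hx z hz))]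
    exact ⟨hT.sub_le x hx z hz, (hT.abs_sub_le x hx z hz).trans
      (by linarith [hT.sub_le x hx z hz])⟩
  obtain ⟨c1, c2⟩ := hA hy
  obtain ⟨c3, c4⟩ := hA hz
  have e1 : p y - p x = (t₂ - t₁) * p v + (p w₂ - p w₁) := by rw [hx', hy']; simp; ring
  have e2 : q y - q x = (t₂ - t₁) * q v + (q w₂ - q w₁) := by rw [hx', hy']; simp; ring
  have e3 : p z - p x = (t₃ - t₁) * p v + (p w₃ - p w₁) := by rw [hx', hz']; simp; ring
  have e4 : q z - q x = (t₃ - t₁) * q v + (q w₃ - q w₁) := by rw [hx', hz']; simp; ring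
  have hmul {a b A B : ℝ} (ha : |a| ≤ A) (hb : |b| ≤ B) : |a * b| ≤ A * B := by
    rw [abs_mul]
    exact mul_le_mul ha hb (abs_nonneg _) ((abs_nonneg _).trans ha)
  have key : |(q z - q x) * (p y - p x) - (q y - q x) * (p z - p x)| ≤ 42 * D * r := by
    have hdet : (q z - q x) * (p y - p x) - (q y - q x) * (p z - p x) =
        ((p y - p x) * (q w₃ - q w₁) - (q y - q x) * (p w₃ - p w₁)) +
        ((p w₂ - p w₁) * (q z - q x) - (q w₂ - q w₁) * (p z - p x)) -
        ((p w₂ - p w₁) * (q w₃ - q w₁) - (q w₂ - q w₁) * (p w₃ - p w₁)) := by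
      rw [e1, e2, e3, e4]; ring
    rw [hdet]
    have hr2 : r * r ≤ D * r := by nlinarith
    calc _ ≤ ((D * (4 * r) + D / 4 * (4 * r)) + (4 * r * (D / 4) + 4 * r * D)) +
          (4 * r * (4 * r) + 4 * r * (4 * r)) := by
          refine (abs_sub _ _).trans (add_le_add ((abs_add_le _ _).trans (add_le_add ?_ ?_)) ?_)
          · exact (abs_sub _ _).trans (add_le_add (hmul c1 b4) (hmul c2 b3))
          · exact (abs_sub _ _).trans (add_le_add (hmul b1 c4) (hmul b2 c3))
          · exact (abs_sub _ _).trans (add_le_add (hmul b1 b4) (hmul b2 b3))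
      _ = 10 * (D * r) + 32 * (r * r) := by ring
      _ ≤ 42 * D * r := by linarith
  refine mem_strip_joinLine_iff.2 ?_
  have e5 : (q z - q x) - (q y - q x) / (p y - p x) * (p z - p x) =
      ((q z - q x) * (p y - p x) - (q y - q x) * (p z - p x)) / (p y - p x) := by
    field_simp
  rw [e5, abs_div, abs_of_pos hpos, div_mul_eq_mul_div]
  exact div_le_div₀ (by positivity) key hδ (hT.le_sub x hx y hy)

theorem measure_strip_le_of_mem_thinPairs {α : Type*} [MeasurableSpace α] {p q : α → ℝ}
    {ν : Measure α} (hν : ν univ ≤ 1) {K σ : ℝ} (hK : 0 < K) (hσ0 : 0 ≤ σ) (hσ1 : σ ≤ 1) {x y : α}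
    (hxy : (x, y) ∈ thinPairs p q ν K σ) {ρ : ℝ} (hρ : 0 < ρ) :
    ν (strip p q (joinLine p q x y) ρ) ≤ ENNReal.ofReal ((2 * K + 1) * ρ ^ σ) := by
  rcases le_or_gt ρ 1 with h | h
  · obtain ⟨n, hn1, hn2⟩ := exists_nat_pow_near_of_lt_one (y := (1 / 2 : ℝ)) hρ h
      (by norm_num) (by norm_num)
    refine (measure_mono (strip_mono hn2)).trans ((hxy n).trans (ENNReal.ofReal_le_ofReal ?_))
    have h1 : ((1 / 2 : ℝ) ^ n) ^ σ ≤ (2 * ρ) ^ σ := by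
      refine Real.rpow_le_rpow (by positivity) ?_ hσ0
      rw [pow_succ] at hn1
      linarith
    have h2 : (2 : ℝ) ^ σ ≤ 2 := Real.rpow_le_self_of_one_le (by norm_num) hσ1
    have h3 : 0 ≤ ρ ^ σ := by positivity
    rw [Real.mul_rpow (by norm_num) hρ.le] at h1
    calc K * ((1 / 2 : ℝ) ^ n) ^ σ ≤ K * (2 * ρ ^ σ) := by gcongr; exact h1.trans (by gcongr)
      _ ≤ (2 * K + 1) * ρ ^ σ := by linarith
  · refine (measure_mono (subset_univ _)).trans (hν.trans ?_)
    rw [← ENNReal.ofReal_one]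
    refine ENNReal.ofReal_le_ofReal ?_
    have := Real.one_le_rpow h.le hσ0
    nlinarith

/-- The set `G` of pairs has thin tubes, quantitatively away from the diagonal and from infinity. -/
structure IsThinSet (μ ν : Measure E2) (G : Set (E2 × E2)) (D K σ : ℝ) : Prop where
  measurableSet : MeasurableSet G
  subset : G ⊆ msupport μ ×ˢ msupport ν
  ne : ∀ w ∈ G, w.1 ≠ w.2
  dist_le : ∀ w ∈ G, dist w.1 w.2 ≤ D
  tube_le : ∀ x : E2, ∀ r : ℝ, 0 < r → ∀ ℓ : Set E2, IsAffineLine ℓ → x ∈ cthickening r ℓ →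
    ν (cthickening r ℓ ∩ {y | (x, y) ∈ G}) ≤ ENNReal.ofReal (K * r ^ σ)

theorem measurableSet_msupport (μ : Measure E2) : MeasurableSet (msupport μ) := by
  rw [msupport_eq_support]
  exact Measure.isClosed_support.measurableSet

theorem msupport_mem_ae (μ : Measure E2) : msupport μ ∈ ae μ := by
  rw [msupport_eq_support]
  exact Measure.support_mem_ae

theorem exists_mem_msupport_ne {μ ν : Measure E2} {t : ℝ} (hμ : μ ≠ 0) (hν : ν ≠ 0) (ht : 0 < t)
    (h : energy ν t < ⊤) : ∃ x ∈ msupport μ, ∃ y ∈ msupport ν, x ≠ y := by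
  rw [msupport_eq_support, msupport_eq_support]
  obtain ⟨x, hx⟩ := Measure.nonempty_support hμ
  refine ⟨x, hx, ?_⟩
  by_contra! hc
  refine hν (Measure.measure_univ_eq_zero.1 ?_)
  have h1 : (univ : Set E2) = {x} ∪ ν.supportᶜ := by
    refine (eq_univ_of_forall fun y => ?_).symm
    by_cases hy : y ∈ ν.support
    · exact Or.inl (hc y hy).symm
    · exact Or.inr hy
  rw [h1]
  exact measure_union_null (measure_singleton_eq_zero_of_energy ht h x) Measure.measure_compl_support

theorem exists_isThinSet {s t σ : ℝ} (hs0 : 0 ≤ s) (ht1 : 1 < t) (ht2 : t ≤ 2)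
    (μ ν : Measure E2) [IsProbabilityMeasure μ] [IsProbabilityMeasure ν]
    (hμ : energy μ s < ⊤) (hν : energy ν t < ⊤) (hσ0 : 0 ≤ σ) (hσ1 : σ < 1)
    (hσ : σ < s + t - 1) :
    ∃ (G : Set (E2 × E2)) (D K : ℝ), 0 < D ∧ 0 < K ∧ 0 < (μ.prod ν) G ∧
      IsThinSet μ ν G D K σ := by
  obtain ⟨x₀, hx₀, y₀, hy₀, hne⟩ := exists_mem_msupport_ne (IsProbabilityMeasure.ne_zero μ)
    (IsProbabilityMeasure.ne_zero ν) (by linarith) hν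
  obtain ⟨p, q, hpq, hpu, hqu⟩ := exists_isOrthoCoord (sub_ne_zero.2 hne.symm)
  set d := ‖y₀ - x₀‖ / 10 with hd
  have hd0 : 0 < d := by
    have := norm_pos_iff.2 (sub_ne_zero.2 hne.symm)
    positivity
  set X := closedBall x₀ d ∩ msupport μ with hX
  set Y := closedBall y₀ d ∩ msupport ν with hY
  set δ := 5 * d
  set D := 12 * d + 1
  have hT : IsTransversal p q X Y δ D :=
    (isTransversal_closedBall hpq hne hpu hqu hd).mono inter_subset_left inter_subset_left
  have hXm : MeasurableSet X := measurableSet_closedBall.inter (measurableSet_msupport μ)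
  have hYm : MeasurableSet Y := measurableSet_closedBall.inter (measurableSet_msupport ν)
  have hpos {m : Measure E2} {z : E2} (hz : z ∈ msupport m) :
      m.restrict (closedBall z d ∩ msupport m) ≠ 0 := by
    rw [ne_eq, Measure.restrict_eq_zero, measure_inter_conull (msupport_mem_ae m)]
    exact ((hz d hd0).trans_le (measure_mono ball_subset_closedBall)).ne'
  have hν1 : (ν.restrict Y) univ ≤ 1 := by
    rw [Measure.restrict_apply_univ]; exact prob_le_one
  have hmin : energy μ (min s σ) < ⊤ := energy_lt_top_of_le (min_le_left _ _) (le_min hs0 hσ0) hμ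
  obtain ⟨K, hK, hKpos⟩ := exists_measure_thinPairs_pos (μ := μ.restrict X) (ν := ν.restrict Y) hT
    (hpos hx₀) (hpos hy₀) hν1 (ae_restrict_mem hXm) (ae_restrict_mem hYm)
    p.continuous.measurable q.continuous.measurable hpq.dist_le (le_min hs0 hσ0)
    (min_le_right s σ) hσ1 (by linarith) ht2
    (by rcases min_choice s σ with h | h <;> rw [h] <;> linarith)
    ((lintegral_edist_restrict_prod_le Y).trans_lt hν).ne
    ((lintegral_edist_restrict_prod_le X).trans_lt hmin).ne
  have hGm : MeasurableSet (thinPairs p q (ν.restrict Y) K σ) :=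
    measurableSet_thinPairs p.continuous.measurable q.continuous.measurable
  have hC : 0 < 42 * D / δ := by positivity
  refine ⟨thinPairs p q (ν.restrict Y) K σ ∩ X ×ˢ Y, ‖y₀ - x₀‖ + 2 * d,
    (2 * K + 1) * (42 * D / δ) ^ σ + 1, by positivity, by positivity, ?_,
    ⟨hGm.inter (hXm.prod hYm), ?_, ?_, ?_, ?_⟩⟩
  · rwa [Measure.prod_restrict, Measure.restrict_apply hGm] at hKpos
  · rintro w ⟨-, hx, hy⟩
    exact ⟨hx.2, hy.2⟩
  · rintro w ⟨-, hx, hy⟩ h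
    have := hT.le_sub _ hx _ hy
    rw [h, sub_self] at this
    exact hT.pos.not_ge this
  · rintro w ⟨-, hx, hy⟩
    have h1 := mem_closedBall.1 hx.1
    have h2 := mem_closedBall'.1 hy.1
    have h3 := dist_triangle4 w.1 x₀ y₀ w.2
    rw [dist_comm x₀, dist_eq_norm y₀] at h3
    linarith
  · intro x r hr ℓ hℓ hx
    set G := thinPairs p q (ν.restrict Y) K σ ∩ X ×ˢ Y
    rcases (cthickening r ℓ ∩ {y | (x, y) ∈ G}).eq_empty_or_nonempty with he | ⟨y, hyℓ, hyG⟩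
    · simp [he]
    rcases le_or_gt r 1 with hr1 | hr1
    · calc _ ≤ ν (strip p q (joinLine p q x y) (42 * D / δ * r) ∩ Y) := by
            refine measure_mono fun z ⟨hzℓ, hzG⟩ => ⟨?_, hzG.2.2⟩
            exact mem_strip_joinLine_of_mem_cthickening hpq hT hr hr1 hℓ hyG.2.1 hyG.2.2 hzG.2.2
              hx hyℓ hzℓ
        _ ≤ (ν.restrict Y) (strip p q (joinLine p q x y) (42 * D / δ * r)) :=
            Measure.le_restrict_apply _ _
        _ ≤ ENNReal.ofReal ((2 * K + 1) * (42 * D / δ * r) ^ σ) :=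
            measure_strip_le_of_mem_thinPairs hν1 hK hσ0 hσ1.le hyG.1 (by positivity)
        _ ≤ _ := by
            refine ENNReal.ofReal_le_ofReal ?_
            rw [Real.mul_rpow hC.le hr.le, ← mul_assoc]
            gcongr
            linarith
    · refine prob_le_one.trans ?_
      rw [← ENNReal.ofReal_one]
      refine ENNReal.ofReal_le_ofReal ?_
      have h1 := Real.one_le_rpow hr1.le hσ0
      have h2 : 0 ≤ (2 * K + 1) * (42 * D / δ) ^ σ := by positivity
      nlinarith

theorem ofReal_le_dimH_of_measure_closedBall_le {E : Type*} [MetricSpace E] [MeasurableSpace E]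
    [BorelSpace E] {m : Measure E} {C σ : ℝ} (hC : 0 < C) (hσ : 0 ≤ σ)
    (h : ∀ w, ∀ ρ : ℝ, 0 < ρ → m (closedBall w ρ) ≤ ENNReal.ofReal (C * ρ ^ σ)) {A : Set E}
    (hA : m A ≠ 0) : ENNReal.ofReal σ ≤ dimH A := by
  have hC0 : ENNReal.ofReal C ≠ 0 := by simpa only [ne_eq, ENNReal.ofReal_eq_zero, not_le]
  have hdiam (S : Set E) (hS : ediam S ≤ 1) : m S ≤ ENNReal.ofReal C * ediam S ^ σ := by
    have htop : ediam S ≠ ⊤ := ne_top_of_le_ne_top ENNReal.one_ne_top hS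
    rcases S.eq_empty_or_nonempty with rfl | ⟨w, hw⟩
    · simp
    have hbound : ∀ ρ ∈ Ioi (ediam S).toReal, m S ≤ ENNReal.ofReal (C * ρ ^ σ) := by
      intro ρ hρ
      refine (measure_mono fun z hz => ?_).trans (h w ρ (ENNReal.toReal_nonneg.trans_lt hρ))
      rw [mem_closedBall, dist_edist]
      exact (ENNReal.toReal_mono htop (edist_le_ediam_of_mem hz hw)).trans (le_of_lt hρ)
    have hcont : Continuous fun ρ : ℝ => ENNReal.ofReal (C * ρ ^ σ) :=
      ENNReal.continuous_ofReal.comp (continuous_const.mul (Real.continuous_rpow_const hσ))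
    have := ge_of_tendsto
      (hcont.continuousWithinAt (s := Ioi (ediam S).toReal) (x := (ediam S).toReal))
      (eventually_mem_nhdsWithin.mono hbound)
    beta_reduce at this
    rwa [ENNReal.ofReal_mul hC.le, ← ENNReal.ofReal_rpow_of_nonneg ENNReal.toReal_nonneg hσ,
      ENNReal.ofReal_toReal htop] at this
  have hle : (ENNReal.ofReal C)⁻¹ • m ≤ μH[σ] := by
    refine Measure.le_hausdorffMeasure σ _ 1 one_pos fun S hS => ?_
    rw [Measure.smul_apply, smul_eq_mul]
    calc _ ≤ (ENNReal.ofReal C)⁻¹ * (ENNReal.ofReal C * ediam S ^ σ) := by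
          gcongr; exact hdiam S hS
      _ = _ := by rw [← mul_assoc, ENNReal.inv_mul_cancel hC0 ENNReal.ofReal_ne_top, one_mul]
  refine le_dimH_of_hausdorffMeasure_ne_zero (d := σ.toNNReal) ?_
  rw [Real.coe_toNNReal _ hσ]
  have hpos : 0 < ((ENNReal.ofReal C)⁻¹ • m) A := by
    rw [Measure.smul_apply, smul_eq_mul]
    exact ENNReal.mul_pos (ENNReal.inv_ne_zero.2 ENNReal.ofReal_ne_top) hA
  exact (hpos.trans_le (hle A)).ne'

theorem measurable_radProj (x : E2) : Measurable (radProj x) := by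
  unfold radProj
  fun_prop

theorem norm_radProj {x y : E2} (h : x ≠ y) : ‖radProj x y‖ = 1 := by
  rw [radProj, norm_smul, norm_inv, norm_norm, inv_mul_cancel₀]
  exact norm_ne_zero_iff.2 (sub_ne_zero.2 h.symm)

theorem IsThinSet.ofReal_le_dimH {μ ν : Measure E2} [SFinite ν] {G : Set (E2 × E2)} {D K σ : ℝ}
    (h : IsThinSet μ ν G D K σ) (hD : 0 < D) (hK : 0 < K) (hσ : 0 ≤ σ) {x : E2}
    (hx : ν (Prod.mk x ⁻¹' G) ≠ 0) :
    ENNReal.ofReal σ ≤ dimH (radProj x '' (msupport ν \ {x})) := by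
  refine ofReal_le_dimH_of_measure_closedBall_le (m := (ν.restrict (Prod.mk x ⁻¹' G)).map (radProj x))
    (C := K * (2 * D) ^ σ) (by positivity) hσ (fun w ρ hρ => ?_) ?_
  · rw [Measure.map_apply (measurable_radProj x) measurableSet_closedBall,
      Measure.restrict_apply (measurable_radProj x measurableSet_closedBall)]
    rcases (radProj x ⁻¹' closedBall w ρ ∩ Prod.mk x ⁻¹' G).eq_empty_or_nonempty
      with he | ⟨y, hyw, hyG⟩
    · simp [he]
    have hr : 0 < 2 * D * ρ := by positivity
    have hv : radProj x y ≠ 0 := by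
      rw [← norm_ne_zero_iff, norm_radProj (h.ne (x, y) hyG)]; exact one_ne_zero
    have htube := h.tube_le x (2 * D * ρ) hr {z | ∃ t : ℝ, z = x + t • radProj x y}
      ⟨x, _, hv, rfl⟩ (self_subset_cthickening _ ⟨0, by simp⟩)
    rw [mul_assoc, ← Real.mul_rpow (by positivity) hρ.le]
    refine le_trans (measure_mono fun z hz => ?_) htube
    obtain ⟨hzw, hzG⟩ := hz
    refine ⟨?_, hzG⟩
    have hz0 : ‖z - x‖ ≠ 0 := norm_ne_zero_iff.2 (sub_ne_zero.2 (h.ne (x, z) hzG).symm)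
    refine mem_cthickening_of_dist_le z (x + ‖z - x‖ • radProj x y) _
      {z | ∃ t : ℝ, z = x + t • radProj x y} ⟨_, rfl⟩ ?_
    have hz : z = x + ‖z - x‖ • radProj x z := by
      rw [radProj, smul_inv_smul₀ hz0]; abel
    have hzD : ‖z - x‖ ≤ D := by
      rw [← dist_eq_norm, dist_comm]
      exact h.dist_le (x, z) hzG
    calc dist z (x + ‖z - x‖ • radProj x y)
        = dist (x + ‖z - x‖ • radProj x z) (x + ‖z - x‖ • radProj x y) :=
          congrArg (dist · (x + ‖z - x‖ • radProj x y)) hz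
      _ = ‖z - x‖ * dist (radProj x z) (radProj x y) := by
          rw [dist_add_left, dist_smul₀, norm_norm]
      _ ≤ D * (ρ + ρ) := by
          gcongr
          exact (dist_triangle_right _ _ w).trans (add_le_add hzw hyw)
      _ = _ := by ring
  · have hsub : Prod.mk x ⁻¹' G ⊆ radProj x ⁻¹' (radProj x '' (msupport ν \ {x})) :=
      fun y hy => mem_image_of_mem _ ⟨(h.subset hy).2, fun h' => h.ne (x, y) hy h'.symm⟩
    refine (lt_of_lt_of_le ?_ (Measure.le_map_apply (measurable_radProj x).aemeasurable _)).ne'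
    rw [Measure.restrict_apply_superset hsub]
    exact pos_iff_ne_zero.2 hx

/-- If `s ∈ [0,2]`, `t ∈ (1,2]`, `I_s(μ) < ∞` and `I_t(ν) < ∞`, then `(μ,ν)` has `σ`-thin
tubes for every `0 ≤ σ < min{s+t−1, 1}`; in particular some `x ∈ spt μ` has
`dim_H π_x(spt ν \ {x}) ≥ σ`. -/
theorem thin_tubes_from_energies (s t : ℝ) (hs0 : 0 ≤ s) (hs2 : s ≤ 2)
    (ht1 : 1 < t) (ht2 : t ≤ 2)
    (μ ν : Measure E2) [IsProbabilityMeasure μ] [IsProbabilityMeasure ν]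
    (hμ : energy μ s < ⊤) (hν : energy ν t < ⊤) :
    ∀ σ : ℝ, 0 ≤ σ → σ < min (s + t - 1) 1 →
      ThinTubes μ ν σ ∧
      ∃ x ∈ msupport μ, ENNReal.ofReal σ ≤ dimH (radProj x '' (msupport ν \ {x})) := by
  intro σ hσ0 hσ
  obtain ⟨hσt, hσ1⟩ := lt_min_iff.1 hσ
  obtain ⟨G, D, K, hD, hK, hpos, hG⟩ := exists_isThinSet hs0 ht1 ht2 μ ν hμ hν hσ0 hσ1 hσt
  refine ⟨⟨K, ((μ.prod ν) G).toReal, hK, ENNReal.toReal_pos hpos.ne' (measure_ne_top _ _), G,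
    hG.measurableSet, hG.subset, (ENNReal.ofReal_toReal (measure_ne_top _ _)).le,
    fun x _ => hG.tube_le x⟩, ?_⟩
  obtain ⟨x, hx⟩ : ∃ x, ν (Prod.mk x ⁻¹' G) ≠ 0 := by
    by_contra! hc
    rw [Measure.prod_apply hG.measurableSet] at hpos
    simp [hc] at hpos
  obtain ⟨y, hy⟩ := nonempty_of_measure_ne_zero hx
  exact ⟨x, (hG.subset hy).1, hG.ofReal_le_dimH hD hK hσ0 hx⟩
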